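/- arXiv:2604.03722 — 4 statements merged into one kernel-verified Lean document; each statement's English description precedes it below -/
import Mathlib

section
/- Let H ∈ (0,1/2) and T > 0. There exists a constant C > 0, depending only on H and T, such that for every N ∈ ℕ, with δ = T/N, and every u ∈ ℝ^N, the step function f = Σ_{i=0}^{N−1} u_{i+1} 1_{[iδ,(i+1)δ)} satisfies (1/2) H (1−2H) ∬_{ℝ×ℝ} (f(x) − f(y))² / |x−y|^{2−2H} dx dy ≥ C δ Σ_{i=1}^{N} u_i². -/
open MeasureTheory Filter Topology

noncomputable section

/-- The step function `f = Σ_{i=0}^{N−1} u_{i+1} 1_{[iδ,(i+1)δ)}` with `δ = T/N`. -/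
def stepFun (T : ℝ) (N : ℕ) (u : Fin N → ℝ) (t : ℝ) : ℝ :=
  ∑ i : Fin N, (Set.Ico ((i : ℝ) * (T / N)) (((i : ℝ) + 1) * (T / N))).indicator
    (fun _ => u i) t

theorem setIntegral_Ioi_sub_rpow {p : ℝ} (hp : 1 < p) {x b : ℝ} (hx : x < b) :
    ∫ y in Set.Ioi b, (y - x) ^ (-p) = (b - x) ^ (1 - p) / (p - 1) := by
  have h := (measurePreserving_sub_right (volume : Measure ℝ) x).setIntegral_preimage_emb
    (MeasurableEquiv.subRight x).measurableEmbedding (fun t : ℝ => t ^ (-p)) (Set.Ioi (b - x))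
  rw [integral_Ioi_rpow_of_lt (by linarith) (sub_pos.2 hx)] at h
  have hpre : (fun y : ℝ => y - x) ⁻¹' Set.Ioi (b - x) = Set.Ioi b := by
    ext y; simp
  rw [hpre] at h
  rw [h, show -p + 1 = -(p - 1) by ring, show 1 - p = -(p - 1) by ring, neg_div_neg_eq]

theorem measurable_abs_sub_rpow (q : ℝ) :
    Measurable (fun z : ℝ × ℝ => |z.1 - z.2| ^ q) := by
  fun_prop

theorem integrableOn_Icc_prod_Ici_abs_sub_rpow {p : ℝ} (hp : 1 < p) (hp2 : p < 2) {a b : ℝ}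
    (hab : a ≤ b) :
    IntegrableOn (fun z : ℝ × ℝ => |z.1 - z.2| ^ (-p)) (Set.Icc a b ×ˢ Set.Ici b) := by
  rw [IntegrableOn, Measure.volume_eq_prod, ← Measure.prod_restrict,
    ← restrict_Ioi_eq_restrict_Ici,
    integrable_prod_iff (measurable_abs_sub_rpow _).aestronglyMeasurable]
  have hlt : ∀ᵐ x ∂(volume.restrict (Set.Icc a b)), x < b := by
    rw [← restrict_Ico_eq_restrict_Icc]
    filter_upwards [ae_restrict_mem measurableSet_Ico] with x hx using hx.2
  have habs : ∀ x < b, ∀ y ∈ Set.Ioi b, |x - y| = y - x := fun x hx y hy => by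
    rw [abs_sub_comm, abs_of_pos (sub_pos.2 (hx.trans hy))]
  constructor
  · filter_upwards [hlt] with x hx
    have h := integrableOn_add_rpow_Ioi_of_lt (a := -p) (c := b) (m := -x) (by linarith)
      (by linarith)
    refine h.congr_fun (fun y hy => ?_) measurableSet_Ioi
    simp only [habs x hx y hy, ← sub_eq_add_neg]
  · have h1 : IntervalIntegrable (fun x : ℝ => (b - x) ^ (1 - p)) volume a b := by
      have h := (intervalIntegral.intervalIntegrable_rpow' (a := b - a) (b := 0) (r := 1 - p)
        (by linarith)).comp_sub_left b
      simpa using h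
    rw [intervalIntegrable_iff_integrableOn_Icc_of_le hab] at h1
    refine (h1.div_const (p - 1)).congr ?_
    filter_upwards [hlt] with x hx
    rw [← setIntegral_Ioi_sub_rpow hp hx]
    refine setIntegral_congr_fun measurableSet_Ioi (fun y hy => ?_)
    simp only [habs x hx y hy]
    rw [Real.norm_of_nonneg (Real.rpow_nonneg (sub_pos.2 (hx.trans hy)).le _)]

theorem integrableOn_Icc_prod_Iic_abs_sub_rpow {p : ℝ} (hp : 1 < p) (hp2 : p < 2) {a b : ℝ}
    (hab : a ≤ b) :
    IntegrableOn (fun z : ℝ × ℝ => |z.1 - z.2| ^ (-p)) (Set.Icc a b ×ˢ Set.Iic a) := by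
  have h := integrableOn_Icc_prod_Ici_abs_sub_rpow hp hp2 (neg_le_neg hab)
  rw [← ((Measure.measurePreserving_neg (volume : Measure (ℝ × ℝ)))).integrableOn_comp_preimage
    (MeasurableEquiv.neg (ℝ × ℝ)).measurableEmbedding] at h
  refine (h.congr_fun (fun z _ => ?_) ?_).mono_set ?_
  · simp only [Function.comp_apply, Prod.fst_neg, Prod.snd_neg]
    rw [← abs_neg]; congr 2; ring
  · exact measurable_neg (measurableSet_Icc.prod measurableSet_Ici)
  · rintro ⟨x, y⟩ ⟨⟨h1, h2⟩, h3⟩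
    simp only [Set.mem_Iic] at h1 h2 h3
    exact ⟨⟨neg_le_neg h2, neg_le_neg h1⟩, neg_le_neg h3⟩

theorem integrable_gagliardo_indicator_Ico {p : ℝ} (hp : 1 < p) (hp2 : p < 2) {a b : ℝ}
    (hab : a ≤ b) (c : ℝ) :
    Integrable (fun z : ℝ × ℝ => ((Set.Ico a b).indicator (fun _ => c) z.1
      - (Set.Ico a b).indicator (fun _ => c) z.2) ^ 2 * |z.1 - z.2| ^ (-p)) := by
  have hR := integrableOn_Icc_prod_Ici_abs_sub_rpow hp hp2 hab
  have hL := integrableOn_Icc_prod_Iic_abs_sub_rpow hp hp2 hab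
  have hU := hR.union hL
  have hU' : IntegrableOn (fun z : ℝ × ℝ => |z.1 - z.2| ^ (-p))
      (Prod.swap ⁻¹' (Set.Icc a b ×ˢ Set.Ici b ∪ Set.Icc a b ×ˢ Set.Iic a)) := by
    have h := ((Measure.measurePreserving_swap (μ := (volume : Measure ℝ))
      (ν := (volume : Measure ℝ))).integrableOn_comp_preimage
      MeasurableEquiv.prodComm.measurableEmbedding).2 hU
    refine h.congr_fun (fun z _ => ?_) ?_
    · simp only [Function.comp_apply, Prod.fst_swap, Prod.snd_swap, abs_sub_comm]
    · exact measurable_swap ((measurableSet_Icc.prod measurableSet_Ici).union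
        (measurableSet_Icc.prod measurableSet_Iic))
  have hS := hU.union hU'
  have hmeas : MeasurableSet ((Set.Icc a b ×ˢ Set.Ici b ∪ Set.Icc a b ×ˢ Set.Iic a) ∪
      Prod.swap ⁻¹' (Set.Icc a b ×ˢ Set.Ici b ∪ Set.Icc a b ×ˢ Set.Iic a)) := by
    have h := (measurableSet_Icc (a := a) (b := b)).prod (measurableSet_Ici (a := b)) |>.union
      ((measurableSet_Icc (a := a) (b := b)).prod (measurableSet_Iic (a := a)))
    exact h.union (measurable_swap h)
  have hInd : Measurable ((Set.Ico a b).indicator (fun _ => c)) :=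
    measurable_const.indicator measurableSet_Ico
  refine ((hS.integrable_indicator hmeas).const_mul (c ^ 2)).mono' ?_ (ae_of_all _ ?_)
  · exact ((((hInd.comp measurable_fst).sub (hInd.comp measurable_snd)).pow_const 2).mul
      (measurable_abs_sub_rpow _)).aestronglyMeasurable
  · rintro ⟨x, y⟩
    have hk : 0 ≤ |x - y| ^ (-p) := Real.rpow_nonneg (abs_nonneg _) _
    rw [Real.norm_of_nonneg (mul_nonneg (sq_nonneg _) hk)]
    by_cases hx : x ∈ Set.Ico a b <;> by_cases hy : y ∈ Set.Ico a b
    · simp only [hx, hy, Set.indicator_of_mem, sub_self]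
      rw [zero_pow two_ne_zero, zero_mul]
      exact mul_nonneg (sq_nonneg _) (Set.indicator_nonneg (fun z _ => by positivity) _)
    · rw [Set.indicator_of_mem (s := _ ∪ _)]
      · simp [hx, hy]
      · simp only [Set.mem_Ico, not_and_or, not_le, not_lt] at hx hy
        rcases hy with hy | hy
        · exact Or.inl (Or.inr ⟨⟨hx.1, hx.2.le⟩, hy.le⟩)
        · exact Or.inl (Or.inl ⟨⟨hx.1, hx.2.le⟩, hy⟩)
    · rw [Set.indicator_of_mem (s := _ ∪ _)]
      · simp [hx, hy]
      · simp only [Set.mem_Ico, not_and_or, not_le, not_lt] at hx hy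
        rcases hx with hx | hx
        · exact Or.inr (Or.inr ⟨⟨hy.1, hy.2.le⟩, hx.le⟩)
        · exact Or.inr (Or.inl ⟨⟨hy.1, hy.2.le⟩, hx⟩)
    · simp only [hx, hy, not_false_eq_true, Set.indicator_of_notMem, sub_self]
      rw [zero_pow two_ne_zero, zero_mul]
      exact mul_nonneg (sq_nonneg _) (Set.indicator_nonneg (fun z _ => by positivity) _)

theorem measurable_stepFun (T : ℝ) (N : ℕ) (u : Fin N → ℝ) : Measurable (stepFun T N u) :=
  Finset.measurable_fun_sum _ fun _ _ => measurable_const.indicator measurableSet_Ico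

theorem integrable_stepFun (T : ℝ) (N : ℕ) (u : Fin N → ℝ) : Integrable (stepFun T N u) :=
  integrable_finsetSum _ fun _ _ =>
    (integrableOn_const (by simp)).integrable_indicator measurableSet_Ico

theorem integrable_gagliardo_stepFun {p : ℝ} (hp : 1 < p) (hp2 : p < 2) {T : ℝ} (hT : 0 ≤ T)
    (N : ℕ) (u : Fin N → ℝ) :
    Integrable (fun z : ℝ × ℝ =>
      (stepFun T N u z.1 - stepFun T N u z.2) ^ 2 / |z.1 - z.2| ^ p) := by
  have hsum := (integrable_finsetSum Finset.univ fun (i : Fin N) _ =>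
    integrable_gagliardo_indicator_Ico hp hp2 (a := (i : ℝ) * (T / N))
      (b := ((i : ℝ) + 1) * (T / N)) (by gcongr; linarith) (u i)).const_mul (N : ℝ)
  refine hsum.mono' ?_ (ae_of_all _ ?_)
  · have hf := measurable_stepFun T N u
    exact ((((hf.comp measurable_fst).sub (hf.comp measurable_snd)).pow_const 2).div
      (measurable_abs_sub_rpow _)).aestronglyMeasurable
  · rintro ⟨x, y⟩
    have hk : 0 ≤ |x - y| ^ (-p) := Real.rpow_nonneg (abs_nonneg _) _
    rw [div_eq_mul_inv, ← Real.rpow_neg (abs_nonneg _),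
      Real.norm_of_nonneg (mul_nonneg (sq_nonneg _) hk), ← Finset.sum_mul, ← mul_assoc]
    refine mul_le_mul_of_nonneg_right ?_ hk
    simp only [stepFun, ← Finset.sum_sub_distrib]
    simpa using sq_sum_le_card_mul_sum_sq (s := (Finset.univ : Finset (Fin N)))
      (f := fun i : Fin N =>
        (Set.Ico ((i : ℝ) * (T / N)) (((i : ℝ) + 1) * (T / N))).indicator (fun _ => u i) x -
        (Set.Ico ((i : ℝ) * (T / N)) (((i : ℝ) + 1) * (T / N))).indicator (fun _ => u i) y)

theorem stepFun_eq_zero_of_notMem {T : ℝ} (hT : 0 ≤ T) {N : ℕ} (u : Fin N → ℝ) {x : ℝ}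
    (hx : x ∉ Set.Ico 0 T) : stepFun T N u x = 0 := by
  refine Finset.sum_eq_zero fun i _ => Set.indicator_of_notMem (fun h => hx ⟨?_, ?_⟩) _
  · exact le_trans (by positivity) h.1
  · have hN : (0 : ℝ) < N := by exact_mod_cast i.pos
    have hi : (i : ℝ) + 1 ≤ N := by exact_mod_cast i.isLt
    calc x < ((i : ℝ) + 1) * (T / N) := h.2
      _ ≤ N * (T / N) := by gcongr
      _ = T := by field_simp

theorem stepFun_eq_of_mem {T : ℝ} (hT : 0 < T) {N : ℕ} (u : Fin N → ℝ) {x : ℝ} {i : Fin N}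
    (hx : x ∈ Set.Ico ((i : ℝ) * (T / N)) (((i : ℝ) + 1) * (T / N))) :
    stepFun T N u x = u i := by
  have hδ : 0 < T / N := div_pos hT (by exact_mod_cast i.pos)
  rw [stepFun, Finset.sum_eq_single i, Set.indicator_of_mem hx]
  · intro j _ hj
    refine Set.indicator_of_notMem (fun hxj => hj ?_) _
    have h1 : (i : ℝ) < j + 1 := lt_of_mul_lt_mul_right (hx.1.trans_lt hxj.2) hδ.le
    have h2 : (j : ℝ) < i + 1 := lt_of_mul_lt_mul_right (hxj.1.trans_lt hx.2) hδ.le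
    have h1' : (i : ℕ) < j + 1 := by exact_mod_cast h1
    have h2' : (j : ℕ) < i + 1 := by exact_mod_cast h2
    exact Fin.ext (by omega)
  · simp

theorem stepFun_sq {T : ℝ} (hT : 0 < T) {N : ℕ} (u : Fin N → ℝ) (x : ℝ) :
    stepFun T N u x ^ 2 = stepFun T N (fun i => u i ^ 2) x := by
  by_cases h : ∃ i : Fin N, x ∈ Set.Ico ((i : ℝ) * (T / N)) (((i : ℝ) + 1) * (T / N))
  · obtain ⟨i, hi⟩ := h
    rw [stepFun_eq_of_mem hT u hi, stepFun_eq_of_mem hT _ hi]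
  · push Not at h
    have h0 (v : Fin N → ℝ) : stepFun T N v x = 0 :=
      Finset.sum_eq_zero fun i _ => Set.indicator_of_notMem (h i) _
    rw [h0, h0, zero_pow two_ne_zero]

theorem integral_stepFun {T : ℝ} (hT : 0 ≤ T) (N : ℕ) (u : Fin N → ℝ) :
    ∫ x, stepFun T N u x = T / N * ∑ i, u i := by
  simp only [stepFun]
  rw [integral_finsetSum _ fun _ _ =>
    (integrableOn_const (by simp)).integrable_indicator measurableSet_Ico, Finset.mul_sum]
  refine Finset.sum_congr rfl fun i _ => ?_
  rw [integral_indicator_const _ measurableSet_Ico, Real.volume_real_Ico_of_le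
    (by gcongr; linarith), smul_eq_mul]
  ring

theorem stepFun_sq_mul_indicator_le {p : ℝ} (hp : 0 ≤ p) {T : ℝ} (hT : 0 < T) {N : ℕ}
    (u : Fin N → ℝ) (x y : ℝ) :
    stepFun T N u x ^ 2 * (Set.Ioc T (2 * T)).indicator (fun _ => ((2 * T) ^ p)⁻¹) y ≤
      (stepFun T N u x - stepFun T N u y) ^ 2 / |x - y| ^ p := by
  by_cases hy : y ∈ Set.Ioc T (2 * T)
  · rw [Set.indicator_of_mem hy, stepFun_eq_zero_of_notMem hT.le u (x := y)
      (fun h => absurd h.2 (not_lt.2 hy.1.le)), sub_zero, div_eq_mul_inv]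
    by_cases hx : x ∈ Set.Ico 0 T
    · have h0 : 0 < |x - y| := abs_pos.2 (by linarith [hx.2, hy.1])
      have h1 : |x - y| ≤ 2 * T := abs_le.2 ⟨by linarith [hx.1, hy.2], by linarith [hx.2, hy.1]⟩
      have := Real.rpow_pos_of_pos h0 p
      gcongr
    · simp [stepFun_eq_zero_of_notMem hT.le u hx]
  · rw [Set.indicator_of_notMem hy, mul_zero]
    exact div_nonneg (sq_nonneg _) (Real.rpow_nonneg (abs_nonneg _) _)

theorem le_integral_gagliardo_stepFun {p : ℝ} (hp : 1 < p) (hp2 : p < 2) {T : ℝ} (hT : 0 < T)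
    (N : ℕ) (u : Fin N → ℝ) :
    (T / N * ∑ i, u i ^ 2) * (T * ((2 * T) ^ p)⁻¹) ≤
      ∫ x, ∫ y, (stepFun T N u x - stepFun T N u y) ^ 2 / |x - y| ^ p := by
  have hF := integrable_gagliardo_stepFun hp hp2 hT.le N u
  have hsq : (fun x => stepFun T N u x ^ 2) = stepFun T N (fun i => u i ^ 2) :=
    funext (stepFun_sq hT u)
  have hf : Integrable (fun x => stepFun T N u x ^ 2) := hsq ▸ integrable_stepFun T N _
  have hg : Integrable ((Set.Ioc T (2 * T)).indicator (fun _ => ((2 * T) ^ p)⁻¹)) :=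
    (integrableOn_const (by simp)).integrable_indicator measurableSet_Ioc
  have hle := integral_mono (hf.mul_prod hg) hF fun z =>
    stepFun_sq_mul_indicator_le (by linarith) hT u z.1 z.2
  rw [integral_prod_mul (fun x => stepFun T N u x ^ 2)
    ((Set.Ioc T (2 * T)).indicator (fun _ => ((2 * T) ^ p)⁻¹)), hsq, integral_stepFun hT.le, integral_indicator_const _ measurableSet_Ioc,
    Real.volume_real_Ioc_of_le (by linarith), smul_eq_mul, show 2 * T - T = T by ring] at hle
  exact hle.trans_eq (integral_prod _ hF)

/-- Lower bound on the Gagliardo seminorm of order `H ∈ (0,1/2)` of a step function: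
`(1/2)H(1−2H) ∬ (f(x)−f(y))²/|x−y|^{2−2H} dx dy ≥ C δ Σᵢ uᵢ²`. -/
theorem gagliardo_stepFun_lower_bound
    (H T : ℝ) (hH : H ∈ Set.Ioo (0 : ℝ) (1 / 2)) (hT : 0 < T) :
    ∃ C > 0, ∀ N : ℕ, 0 < N → ∀ u : Fin N → ℝ,
      C * (T / N) * ∑ i, (u i) ^ 2
        ≤ (1 / 2) * H * (1 - 2 * H) *
            ∫ x : ℝ, ∫ y : ℝ,
              (stepFun T N u x - stepFun T N u y) ^ 2 / |x - y| ^ (2 - 2 * H) := by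
  obtain ⟨hH0, hH1⟩ := hH
  have hc : 0 < 1 / 2 * H * (1 - 2 * H) := mul_pos (by linarith) (by linarith)
  refine ⟨1 / 2 * H * (1 - 2 * H) * (T * ((2 * T) ^ (2 - 2 * H))⁻¹), by positivity,
    fun N _ u => ?_⟩
  have h := mul_le_mul_of_nonneg_left (le_integral_gagliardo_stepFun (p := 2 - 2 * H)
    (by linarith) (by linarith) hT N u) hc.le
  refine le_trans (le_of_eq ?_) h
  ring
end
end

section
/- In the calibration setting for the fractional Ornstein–Uhlenbeck inverse problem, there exists a constant C > 0, depending only on θ and α, such that for every N ∈ ℕ, δ = T/N, and every k = 1,…,N, the interpolation gradients and the calibrated gradients satisfy |δ(c_{B,k} − c_{x,k})| ≤ C M δ^{1+α}. -/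
open MeasureTheory Filter Topology

noncomputable section

/-- Pathwise (variation-of-constants) solution of the fractional Ornstein–Uhlenbeck
equation `dX = −θX dt + σ dB`, with the stochastic integral rewritten by
integration by parts:
`X_t = x₀ e^{−θt} + σ(B_t − θ ∫_0^t e^{−θ(t−u)} B_u du)`. -/
def OUsol (θ σ x₀ : ℝ) (B : ℝ → ℝ) (t : ℝ) : ℝ :=
  x₀ * Real.exp (-(θ * t)) +
    σ * (B t - θ * ∫ u in (0 : ℝ)..t, Real.exp (-(θ * (t - u))) * B u)

/-- Interpolation gradients `c_{B,k} = (B_{kδ} − B_{(k−1)δ})/δ`. -/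
def gradB (B : ℝ → ℝ) (δ : ℝ) (k : ℕ) : ℝ :=
  (B ((k : ℝ) * δ) - B (((k : ℝ) - 1) * δ)) / δ

/-- Calibrated gradients `c_{x,k} = θ(X_{kδ} − X_{(k−1)δ} e^{−θδ})/(σ(1 − e^{−θδ}))`. -/
def gradX (θ σ x₀ : ℝ) (B : ℝ → ℝ) (δ : ℝ) (k : ℕ) : ℝ :=
  θ * (OUsol θ σ x₀ B ((k : ℝ) * δ) - OUsol θ σ x₀ B (((k : ℝ) - 1) * δ) * Real.exp (-(θ * δ)))
    / (σ * (1 - Real.exp (-(θ * δ))))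

/-- The exponential kernel integrates to `1 - e^{-θ(b-a)}` over `[a, b]`. -/
lemma mul_integral_exp_kernel (θ a b : ℝ) :
    θ * ∫ u in a..b, Real.exp (-(θ * (b - u))) = 1 - Real.exp (-(θ * (b - a))) := by
  rw [← intervalIntegral.integral_const_mul,
    intervalIntegral.integral_eq_sub_of_hasDerivAt
      (f := fun u => Real.exp (-(θ * (b - u)))) (fun u _ => ?_)
      (Continuous.intervalIntegrable (by fun_prop) _ _)]
  · simp
  · have h : HasDerivAt (fun u => -(θ * (b - u))) θ u := by
      exact (((hasDerivAt_id u).const_sub b).const_mul θ).fun_neg.congr_deriv (by ring)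
    simpa [mul_comm] using h.exp

/-- A function satisfying a Hölder estimate of positive exponent on a set is continuous there. -/
lemma continuousOn_of_abs_sub_le_rpow {B : ℝ → ℝ} {S : Set ℝ} {M α : ℝ} (hα : 0 < α)
    (hB : ∀ s ∈ S, ∀ t ∈ S, |B t - B s| ≤ M * |t - s| ^ α) : ContinuousOn B S := by
  intro s hs
  rw [ContinuousWithinAt, tendsto_iff_norm_sub_tendsto_zero]
  have h : Tendsto (fun t : ℝ => M * |t - s| ^ α) (𝓝[S] s) (𝓝 0) := by
    have hc : Continuous fun t : ℝ => M * |t - s| ^ α :=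
      continuous_const.mul
        ((continuous_id.sub continuous_const).abs.rpow_const fun _ => Or.inr hα.le)
    simpa [Real.zero_rpow hα.ne'] using (hc.tendsto s).mono_left nhdsWithin_le_nhds
  refine squeeze_zero' (Eventually.of_forall fun _ => norm_nonneg _) ?_ h
  filter_upwards [self_mem_nhdsWithin] with t ht using hB s hs t ht

/-- The one-step increment of the Ornstein–Uhlenbeck solution in terms of the increments
of the driving path. -/
lemma OUsol_sub_mul_exp (θ σ x₀ : ℝ) {B : ℝ → ℝ} {a b : ℝ} (ha : 0 ≤ a) (hab : a ≤ b)
    (hB : ContinuousOn B (Set.Icc 0 b)) :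
    OUsol θ σ x₀ B b - OUsol θ σ x₀ B a * Real.exp (-(θ * (b - a))) =
      σ * ((B b - B a) - θ * ∫ u in a..b, Real.exp (-(θ * (b - u))) * (B u - B a)) := by
  have hint : ∀ c d, 0 ≤ c → c ≤ d → d ≤ b →
      IntervalIntegrable (fun u => Real.exp (-(θ * (b - u))) * B u) volume c d := by
    intro c d hc hcd hd
    apply ContinuousOn.intervalIntegrable
    rw [Set.uIcc_of_le hcd]
    exact ContinuousOn.mul (by fun_prop) (hB.mono (Set.Icc_subset_Icc hc hd))
  have hsplit := intervalIntegral.integral_add_adjacent_intervals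
    (hint 0 a le_rfl ha hab) (hint a b ha hab le_rfl)
  have hshift : (∫ u in (0 : ℝ)..a, Real.exp (-(θ * (b - u))) * B u) =
      Real.exp (-(θ * (b - a))) * ∫ u in (0 : ℝ)..a, Real.exp (-(θ * (a - u))) * B u := by
    rw [← intervalIntegral.integral_const_mul]
    congr 1 with u
    rw [← mul_assoc, ← Real.exp_add]
    ring_nf
  have hincr : (∫ u in a..b, Real.exp (-(θ * (b - u))) * (B u - B a)) =
      (∫ u in a..b, Real.exp (-(θ * (b - u))) * B u) -
        (∫ u in a..b, Real.exp (-(θ * (b - u)))) * B a := by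
    rw [← intervalIntegral.integral_mul_const, ← intervalIntegral.integral_sub
      (hint a b ha hab le_rfl) (Continuous.intervalIntegrable (by fun_prop) _ _)]
    congr 1 with u
    ring
  have hker := mul_integral_exp_kernel θ a b
  have hexp : Real.exp (-(θ * b)) = Real.exp (-(θ * a)) * Real.exp (-(θ * (b - a))) := by
    rw [← Real.exp_add]
    ring_nf
  rw [OUsol, OUsol, ← hsplit, hshift, hincr, hexp]
  linear_combination (-σ * B a) * hker

/-- Exponentially weighted increments are controlled by a uniform bound on the increments. -/
lemma abs_mul_integral_exp_kernel_le {θ a b K : ℝ} {f : ℝ → ℝ} (hθ : 0 < θ) (hab : a ≤ b)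
    (hf : ∀ u ∈ Set.Icc a b, |f u| ≤ K) :
    |θ * ∫ u in a..b, Real.exp (-(θ * (b - u))) * f u| ≤
      K * (1 - Real.exp (-(θ * (b - a)))) := by
  have h : |∫ u in a..b, Real.exp (-(θ * (b - u))) * f u| ≤
      ∫ u in a..b, Real.exp (-(θ * (b - u))) * K := by
    rw [← Real.norm_eq_abs]
    refine intervalIntegral.norm_integral_le_of_norm_le hab (Eventually.of_forall fun u hu => ?_)
      (Continuous.intervalIntegrable (by fun_prop) _ _)
    rw [norm_mul, Real.norm_eq_abs, Real.norm_eq_abs, Real.abs_exp]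
    exact mul_le_mul_of_nonneg_left (hf u (Set.Ioc_subset_Icc_self hu)) (Real.exp_pos _).le
  rw [intervalIntegral.integral_mul_const] at h
  rw [abs_mul, abs_of_pos hθ, ← mul_integral_exp_kernel θ a b]
  calc _ ≤ θ * ((∫ u in a..b, Real.exp (-(θ * (b - u)))) * K) :=
        mul_le_mul_of_nonneg_left h hθ.le
    _ = _ := by ring

/-- For `x > 0`, the ratio `x / (1 - e^{-x})` lies between `1` and `1 + x`. -/
lemma div_one_sub_exp_neg_mem_Icc {x : ℝ} (hx : 0 < x) :
    x / (1 - Real.exp (-x)) ∈ Set.Icc 1 (1 + x) := by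
  have hpos : 0 < 1 - Real.exp (-x) := by simpa using hx
  rw [Set.mem_Icc, le_div_iff₀ hpos, div_le_iff₀ hpos]
  have h₁ := Real.add_one_le_exp (-x)
  have h₂ : (1 + x) * Real.exp (-x) ≤ 1 := by
    rw [Real.exp_neg, ← div_eq_mul_inv, div_le_one (Real.exp_pos x), add_comm]
    exact Real.add_one_le_exp x
  constructor <;> linarith

/-- Calibration error bound: `|δ(c_{B,k} − c_{x,k})| ≤ C M δ^{1+α}`, with `C`
depending only on `θ` and `α`. -/
theorem calibration_gradient_bound (θ α : ℝ) (hθ : 0 < θ) (hα : α ∈ Set.Ioc (0 : ℝ) 1) :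
    ∃ C > 0, ∀ T : ℝ, 0 < T → ∀ σ : ℝ, 0 < σ → ∀ M : ℝ, 0 ≤ M →
      ∀ B : ℝ → ℝ, B 0 = 0 →
        (∀ s ∈ Set.Icc (0 : ℝ) T, ∀ t ∈ Set.Icc (0 : ℝ) T, |B t - B s| ≤ M * |t - s| ^ α) →
        ∀ x₀ : ℝ, ∀ N : ℕ, 0 < N → ∀ k : ℕ, 1 ≤ k → k ≤ N →
          |(T / N) * (gradB B (T / N) k - gradX θ σ x₀ B (T / N) k)|
            ≤ C * M * (T / N) ^ (1 + α) := by
  refine ⟨2 * θ, by positivity, ?_⟩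
  intro T hT σ hσ M hM B _ hB x₀ N hN k hk hkN
  have hN' : (0 : ℝ) < N := by exact_mod_cast hN
  have hk' : (1 : ℝ) ≤ k := by exact_mod_cast hk
  have hkN' : (k : ℝ) ≤ N := by exact_mod_cast hkN
  have hδ : 0 < T / N := div_pos hT hN'
  have hNδ : N * (T / N) = T := by field_simp
  generalize T / N = δ at hδ hNδ ⊢
  have ha : 0 ≤ ((k : ℝ) - 1) * δ := mul_nonneg (by linarith) hδ.le
  have hb : k * δ ≤ T := hNδ ▸ mul_le_mul_of_nonneg_right hkN' hδ.le
  have hba : (k : ℝ) * δ - ((k : ℝ) - 1) * δ = δ := by ring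
  rw [gradB, gradX]
  generalize ((k : ℝ) - 1) * δ = a at ha hba ⊢
  generalize (k : ℝ) * δ = b at hb hba ⊢
  have hab : a ≤ b := by linarith
  have hinc : ∀ u ∈ Set.Icc a b, |B u - B a| ≤ M * δ ^ α := fun u hu => by
    refine (hB a ⟨ha, hab.trans hb⟩ u ⟨ha.trans hu.1, hu.2.trans hb⟩).trans ?_
    rw [abs_of_nonneg (sub_nonneg.2 hu.1)]
    exact mul_le_mul_of_nonneg_left
      (Real.rpow_le_rpow (sub_nonneg.2 hu.1) (by linarith [hu.2]) hα.1.le) hM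
  have hstep := OUsol_sub_mul_exp θ σ x₀ ha hab
    ((continuousOn_of_abs_sub_le_rpow hα.1 hB).mono (Set.Icc_subset_Icc_right hb))
  have hJ := abs_mul_integral_exp_kernel_le hθ hab hinc
  have hD := hinc b ⟨hab, le_rfl⟩
  rw [hba] at hstep hJ
  rw [hstep]
  generalize (θ * ∫ u in a..b, Real.exp (-(θ * (b - u))) * (B u - B a)) = J at hJ ⊢
  generalize B b - B a = D at hD ⊢
  have hx : 0 < θ * δ := mul_pos hθ hδ
  obtain ⟨hr₁, hr₂⟩ := div_one_sub_exp_neg_mem_Icc hx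
  have hw : 0 < 1 - Real.exp (-(θ * δ)) := by simpa using hx
  generalize 1 - Real.exp (-(θ * δ)) = w at hw hJ hr₁ hr₂ ⊢
  have hK : 0 ≤ M * δ ^ α := by positivity
  have hsplit : δ * (D / δ - θ * (σ * (D - J)) / (σ * w)) =
      (1 - θ * δ / w) * D + θ * δ / w * J := by
    field_simp
    ring
  have hfst : |(1 - θ * δ / w) * D| ≤ θ * δ * (M * δ ^ α) := by
    rw [abs_mul]
    refine mul_le_mul ?_ hD (abs_nonneg _) hx.le
    rw [abs_le]
    constructor <;> linarith
  have hsnd : |θ * δ / w * J| ≤ θ * δ * (M * δ ^ α) := by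
    rw [abs_mul, abs_of_pos (div_pos hx hw)]
    calc _ ≤ θ * δ / w * (M * δ ^ α * w) := mul_le_mul_of_nonneg_left hJ (div_pos hx hw).le
      _ = _ := by field_simp
  rw [hsplit, Real.rpow_add hδ, Real.rpow_one]
  calc _ ≤ _ := abs_add_le _ _
    _ ≤ θ * δ * (M * δ ^ α) + θ * δ * (M * δ ^ α) := add_le_add hfst hsnd
    _ = _ := by ring
end
end

section
/- In the approximate fractional Ornstein–Uhlenbeck likelihood setting, let B^H be a fractional Brownian motion on [0,T] with Hurst parameter H ∈ (0,1), and for each N ∈ ℕ (with δ = T/N) take the driver increments b_k = B^H_{kδ} − B^H_{(k−1)δ}, k = 1,…,N, and let x^δ be the data generated recursively from b. Then, almost surely, ∂_σ( δ ℓ_δ(x^δ | θ, σ) ) |_{θ=θ₀, σ=σ₀} → 0 as N → ∞ (i.e. as δ → 0 with T fixed); equivalently, (1/N) bᵀ (Σ^H_{δ,N})⁻¹ b → 1 almost surely. -/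
open MeasureTheory ProbabilityTheory Filter Matrix Topology

noncomputable section

/-- Covariance matrix of the increments, over a grid of mesh `δ`, of fractional Brownian
motion with Hurst parameter `H`. -/
def SigmaH (H δ : ℝ) (N : ℕ) : Matrix (Fin N) (Fin N) ℝ := fun i j =>
  δ ^ (2 * H) / 2 *
    (|(i : ℝ) - (j : ℝ) + 1| ^ (2 * H) + |(i : ℝ) - (j : ℝ) - 1| ^ (2 * H)
      - 2 * |(i : ℝ) - (j : ℝ)| ^ (2 * H))

/-- `φ_δ(θ) = (1 − e^{−θδ})/(θδ)`. -/
def phiDelta (δ θ : ℝ) : ℝ := (1 - Real.exp (-(θ * δ))) / (θ * δ)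

/-- Data generated recursively by the approximate fractional Ornstein–Uhlenbeck model:
`x_k = e^{−θ₀δ} x_{k−1} + σ₀ φ_δ(θ₀) b_k`, `x_0 = x₀`. -/
def xrec (θ₀ σ₀ δ x₀ : ℝ) (b : ℕ → ℝ) : ℕ → ℝ
  | 0 => x₀
  | k + 1 => Real.exp (-(θ₀ * δ)) * xrec θ₀ σ₀ δ x₀ b k + σ₀ * phiDelta δ θ₀ * b (k + 1)

/-- The increment vector `(Δ_{δ,θ}x)_k = x_k − x_{k−1} e^{−θδ}`. -/
def deltaVec (θ δ : ℝ) (x : ℕ → ℝ) (N : ℕ) : Fin N → ℝ := fun k =>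
  x ((k : ℕ) + 1) - x (k : ℕ) * Real.exp (-(θ * δ))

/-- Log-likelihood of the approximate fractional Ornstein–Uhlenbeck model:
`ℓ_δ(x | θ, σ) = −(1/(2σ²φ_δ(θ)²)) Δᵀ (Σ^H_{δ,N})⁻¹ Δ − N log(σ φ_δ(θ))`. -/
def loglik (H δ : ℝ) (N : ℕ) (x : ℕ → ℝ) (θ σ : ℝ) : ℝ :=
  -(1 / (2 * σ ^ 2 * phiDelta δ θ ^ 2)) *
      (deltaVec θ δ x N ⬝ᵥ ((SigmaH H δ N)⁻¹ *ᵥ deltaVec θ δ x N))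
    - (N : ℝ) * Real.log (σ * phiDelta δ θ)

/-- Covariance function of (one-sided) fractional Brownian motion. -/
def fbmCov (H s t : ℝ) : ℝ :=
  (|s| ^ (2 * H) + |t| ^ (2 * H) - |s - t| ^ (2 * H)) / 2

/-- `B` is a fractional Brownian motion with Hurst parameter `H` on `[0,T]`. -/
structure IsFBMOn {Ω : Type*} [MeasureSpace Ω] (H T : ℝ) (B : ℝ → Ω → ℝ) : Prop where
  meas : ∀ t, Measurable (B t)
  cont : ∀ᵐ ω : Ω, ContinuousOn (fun t => B t ω) (Set.Icc 0 T)
  zero : ∀ᵐ ω : Ω, B 0 ω = 0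
  gaussian : ∀ (n : ℕ) (t : Fin n → ℝ), (∀ i, t i ∈ Set.Icc 0 T) → ∀ a : Fin n → ℝ,
    Measure.map (fun ω => ∑ i, a i * B (t i) ω) (ℙ : Measure Ω)
      = gaussianReal 0 (∑ i, ∑ j, a i * a j * fbmCov H (t i) (t j)).toNNReal


theorem integrable_exp_mul_sq_gaussianReal {s : ℝ} (hs : s < 1 / 2) :
    Integrable (fun x : ℝ => Real.exp (s * x ^ 2)) (gaussianReal 0 1) := by
  rw [gaussianReal_of_var_ne_zero _ one_ne_zero,
    integrable_withDensity_iff_integrable_smul' (measurable_gaussianPDF _ _)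
      (ae_of_all _ fun _ => gaussianPDF_lt_top)]
  refine ((integrable_exp_neg_mul_sq (b := 1 / 2 - s) (by linarith)).const_mul
    (√(2 * Real.pi))⁻¹).congr (ae_of_all _ fun x => ?_)
  simp only [toReal_gaussianPDF, gaussianPDFReal, smul_eq_mul, NNReal.coe_one, mul_one, sub_zero]
  rw [mul_assoc, ← Real.exp_add]
  ring_nf

theorem integral_exp_mul_sq_gaussianReal {s : ℝ} (hs : s < 1 / 2) :
    ∫ x, Real.exp (s * x ^ 2) ∂(gaussianReal 0 1) = (√(1 - 2 * s))⁻¹ := by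
  rw [integral_gaussianReal_eq_integral_smul one_ne_zero]
  have h : ∀ x : ℝ, gaussianPDFReal 0 1 x • Real.exp (s * x ^ 2)
      = (√(2 * Real.pi))⁻¹ * Real.exp (-(1 / 2 - s) * x ^ 2) := fun x => by
    simp only [gaussianPDFReal, smul_eq_mul, NNReal.coe_one, mul_one, sub_zero]
    rw [mul_assoc, ← Real.exp_add]
    ring_nf
  simp_rw [h]
  rw [integral_const_mul, integral_gaussian, ← Real.sqrt_inv, ← Real.sqrt_inv,
    ← Real.sqrt_mul (by positivity)]
  congr 1
  have : 1 / 2 - s ≠ 0 := by linarith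
  have : 1 - 2 * s ≠ 0 := by linarith
  field_simp

theorem one_le_one_sub_mul_exp {y : ℝ} (hy : |y| ≤ 1 / 2) :
    1 ≤ (1 - y) * Real.exp (y + y ^ 2) := by
  obtain ⟨h1, h2⟩ := abs_le.1 hy
  rcases le_total y 0 with h | h
  · have := Real.add_one_le_exp (y + y ^ 2)
    nlinarith [pow_nonneg (neg_nonneg.2 h) 3, mul_le_mul_of_nonneg_left this
      (by linarith : 0 ≤ 1 - y)]
  · have := Real.quadratic_le_exp_of_nonneg (x := y + y ^ 2) (by positivity)
    have h3 := mul_le_mul_of_nonneg_left this (by linarith : 0 ≤ 1 - y)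
    refine le_trans ?_ h3
    have : 0 ≤ y ^ 2 * (1 - y - y ^ 2 - y ^ 3) := by
      apply mul_nonneg (by positivity)
      nlinarith [mul_nonneg h h, mul_nonneg (mul_nonneg h h) h]
    nlinarith

theorem inv_sqrt_one_sub_le_exp {s : ℝ} (hs : |s| ≤ 1 / 4) :
    (√(1 - 2 * s))⁻¹ ≤ Real.exp (s + 2 * s ^ 2) := by
  obtain ⟨h1, h2⟩ := abs_le.1 hs
  have h := one_le_one_sub_mul_exp (y := 2 * s) (by rw [abs_mul, abs_two]; linarith)
  have hpos : 0 < 1 - 2 * s := by linarith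
  rw [← Real.sqrt_inv]
  apply Real.sqrt_le_iff.2 ⟨(Real.exp_pos _).le, ?_⟩
  rw [← Real.exp_nat_mul, inv_le_iff_one_le_mul₀' hpos]
  rw [show ((2 : ℕ) : ℝ) * (s + 2 * s ^ 2) = 2 * s + (2 * s) ^ 2 by push_cast; ring]
  exact h

theorem integrable_exp_mul_sum_sq_pi_gaussianReal (N : ℕ) {s : ℝ} (hs : s < 1 / 2) :
    Integrable (fun z : Fin N → ℝ => Real.exp (s * ∑ i, z i ^ 2))
      (Measure.pi fun _ : Fin N => gaussianReal 0 1) := by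
  simp_rw [Finset.mul_sum, Real.exp_sum]
  exact Integrable.fintype_prod (f := fun _ : Fin N => fun x : ℝ => Real.exp (s * x ^ 2))
    fun _ => integrable_exp_mul_sq_gaussianReal hs

theorem mgf_sum_sq_pi_gaussianReal_le (N : ℕ) {s : ℝ} (hs : |s| ≤ 1 / 4) :
    mgf (fun z : Fin N → ℝ => ∑ i, z i ^ 2) (Measure.pi fun _ : Fin N => gaussianReal 0 1) s
      ≤ Real.exp (N * (s + 2 * s ^ 2)) := by
  have hs' : s < 1 / 2 := by linarith [(abs_le.1 hs).2]
  unfold mgf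
  simp_rw [Finset.mul_sum, Real.exp_sum]
  rw [integral_fintype_prod_eq_prod (f := fun (_ : Fin N) (x : ℝ) => Real.exp (s * x ^ 2)),
    integral_exp_mul_sq_gaussianReal hs', Finset.prod_const, Finset.card_univ, Fintype.card_fin,
    Real.exp_nat_mul]
  exact pow_le_pow_left₀ (by positivity) (inv_sqrt_one_sub_le_exp hs) N

/-- Chernoff bound for the chi-squared distribution with `N` degrees of freedom. -/
theorem measureReal_abs_sum_sq_sub_ge_le (N : ℕ) {ε : ℝ} (hε : 0 < ε) (hε1 : ε ≤ 1) :
    (Measure.pi fun _ : Fin N => gaussianReal 0 1).real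
        {z | ε * N ≤ |∑ i, z i ^ 2 - N|} ≤ 2 * Real.exp (-(ε ^ 2 / 8)) ^ N := by
  have habs : |ε / 4| ≤ 1 / 4 := by rw [abs_of_pos (by positivity)]; linarith
  have habs' : |-(ε / 4)| ≤ 1 / 4 := by rwa [abs_neg]
  have h1 := measure_ge_le_exp_mul_mgf
    (μ := Measure.pi fun _ : Fin N => gaussianReal 0 1) (X := fun z => ∑ i, z i ^ 2)
    (t := ε / 4) (N + ε * N) (by positivity)
    (integrable_exp_mul_sum_sq_pi_gaussianReal N (by linarith))
  have h2 := measure_le_le_exp_mul_mgf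
    (μ := Measure.pi fun _ : Fin N => gaussianReal 0 1) (X := fun z => ∑ i, z i ^ 2)
    (t := -(ε / 4)) (N - ε * N) (by linarith)
    (integrable_exp_mul_sum_sq_pi_gaussianReal N (by linarith))
  have h1' := h1.trans (mul_le_mul_of_nonneg_left (mgf_sum_sq_pi_gaussianReal_le N habs)
    (Real.exp_pos _).le)
  have h2' := h2.trans (mul_le_mul_of_nonneg_left (mgf_sum_sq_pi_gaussianReal_le N habs')
    (Real.exp_pos _).le)
  rw [← Real.exp_add] at h1' h2'
  have hsub : {z : Fin N → ℝ | ε * N ≤ |∑ i, z i ^ 2 - N|}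
      ⊆ {z | N + ε * N ≤ ∑ i, z i ^ 2} ∪ {z | ∑ i, z i ^ 2 ≤ N - ε * N} := by
    intro z hz
    rcases le_abs.1 (show ε * N ≤ |∑ i, z i ^ 2 - N| from hz) with h | h
    · left
      simp only [Set.mem_ofPred_eq]
      linarith
    · right
      simp only [Set.mem_ofPred_eq]
      linarith
  refine (measureReal_mono hsub).trans ((measureReal_union_le _ _).trans ?_)
  rw [two_mul, ← Real.exp_nat_mul]
  refine add_le_add (h1'.trans_eq ?_) (h2'.trans_eq ?_) <;> congr 1 <;> ring

open scoped MatrixOrder in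
/-- A nondegenerate centered Gaussian vector can be whitened. -/
theorem exists_map_eq_pi_gaussianReal {Ω : Type*} [MeasurableSpace Ω] {μ : Measure Ω}
    [IsProbabilityMeasure μ] {N : ℕ} {S : Matrix (Fin N) (Fin N) ℝ} (hS : S.PosDef)
    {X : Ω → Fin N → ℝ} (hX : Measurable X)
    (hlaw : ∀ a : Fin N → ℝ,
      μ.map (fun ω => a ⬝ᵥ X ω) = gaussianReal 0 (a ⬝ᵥ (S *ᵥ a)).toNNReal) :
    ∃ Z : Ω → Fin N → ℝ, Measurable Z ∧
      μ.map Z = Measure.pi (fun _ => gaussianReal 0 1) ∧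
      ∀ ω, X ω ⬝ᵥ (S⁻¹ *ᵥ X ω) = ∑ i, Z ω i ^ 2 := by
  obtain ⟨y, hy, rfl⟩ := CStarAlgebra.isStrictlyPositive_iff_eq_star_mul_self.mp
    hS.isStrictlyPositive
  rw [star_eq_conjTranspose, conjTranspose_eq_transpose_of_trivial] at hlaw ⊢
  have hdet : IsUnit y.det := (isUnit_iff_isUnit_det y).1 hy
  have hinv : y * y⁻¹ = 1 := mul_nonsing_inv y hdet
  have hZ : Measurable fun ω => (y⁻¹)ᵀ *ᵥ X ω := by
    refine measurable_pi_lambda _ fun i => ?_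
    simp only [mulVec, dotProduct]
    fun_prop
  refine ⟨fun ω => (y⁻¹)ᵀ *ᵥ X ω, hZ, ?_, fun ω => ?_⟩
  · have := Measure.isProbabilityMeasure_map (μ := μ) hZ.aemeasurable
    rw [← charFun_eq_pi_iff]
    intro t
    have hlin : ∀ ω, (y⁻¹ *ᵥ t.ofLp) ⬝ᵥ X ω = t.ofLp ⬝ᵥ ((y⁻¹)ᵀ *ᵥ X ω) := fun ω => by
      rw [dotProduct_mulVec, vecMul_transpose]
    have hvar : (y⁻¹ *ᵥ t.ofLp) ⬝ᵥ ((yᵀ * y) *ᵥ (y⁻¹ *ᵥ t.ofLp)) = ∑ i, t i ^ 2 := by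
      rw [← mulVec_mulVec, mulVec_mulVec (M := y), hinv, one_mulVec, dotProduct_mulVec,
        vecMul_transpose, mulVec_mulVec, hinv, one_mulVec]
      simp [dotProduct, sq]
    have h := hlaw (y⁻¹ *ᵥ t.ofLp)
    rw [hvar] at h
    have hc := congrArg (fun ν => charFun ν (1 : ℝ)) h
    simp only [charFun_gaussianReal] at hc ⊢
    rw [charFun_apply_real, integral_map (by simp only [dotProduct]; fun_prop)
      (by fun_prop)] at hc
    rw [charFun_apply, integral_map (by fun_prop) (by fun_prop),
      integral_map hZ.aemeasurable (by fun_prop)]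
    simp only [PiLp.inner_apply]
    simp_rw [hlin] at hc
    rw [← Complex.exp_sum]
    convert hc using 2
    · ext ω
      simp [dotProduct]
    · rw [Real.coe_toNNReal _ (by positivity)]
      simp [Finset.sum_div]
  · rw [Matrix.mul_inv_rev, ← transpose_nonsing_inv, ← mulVec_mulVec, dotProduct_mulVec,
      ← mulVec_transpose]
    simp [dotProduct, sq]

/-- The integrand in the harmonisable representation of `|x| ^ (2 * H)`. -/
theorem integrableOn_one_sub_cos_mul_rpow {H : ℝ} (hH : H ∈ Set.Ioo (0 : ℝ) 1) (x : ℝ) :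
    IntegrableOn (fun u => (1 - Real.cos (x * u)) * u ^ (-1 - 2 * H)) (Set.Ioi (0 : ℝ)) := by
  obtain ⟨h0, h1⟩ := hH
  have hmeas : Measurable fun u : ℝ => (1 - Real.cos (x * u)) * u ^ (-1 - 2 * H) := by fun_prop
  rw [← Set.Ioc_union_Ioi_eq_Ioi (zero_le_one' ℝ)]
  refine IntegrableOn.union ?_ ?_
  · have hint : IntegrableOn (fun u : ℝ => x ^ 2 / 2 * u ^ (1 - 2 * H)) (Set.Ioc 0 1) :=
      ((intervalIntegrable_iff_integrableOn_Ioc_of_le zero_le_one).1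
        (intervalIntegral.intervalIntegrable_rpow' (by linarith))).const_mul _
    refine hint.mono' hmeas.aestronglyMeasurable ?_
    filter_upwards [ae_restrict_mem measurableSet_Ioc] with u hu
    have hu0 : 0 < u := hu.1
    rw [Real.norm_of_nonneg (mul_nonneg (by linarith [Real.cos_le_one (x * u)])
      (Real.rpow_nonneg hu0.le _))]
    have h2 : u ^ (1 - 2 * H) = u ^ 2 * u ^ (-1 - 2 * H) := by
      rw [← Real.rpow_natCast, ← Real.rpow_add hu0]
      congr 1
      push_cast
      ring
    rw [h2, ← mul_assoc]
    refine mul_le_mul_of_nonneg_right ?_ (Real.rpow_nonneg hu0.le _)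
    have := Real.one_sub_sq_div_two_le_cos (x := x * u)
    linarith [mul_pow x u 2]
  · have hint : IntegrableOn (fun u : ℝ => 2 * u ^ (-1 - 2 * H)) (Set.Ioi 1) :=
      (integrableOn_Ioi_rpow_of_lt (by linarith) zero_lt_one).const_mul _
    refine hint.mono' hmeas.aestronglyMeasurable ?_
    filter_upwards [ae_restrict_mem measurableSet_Ioi] with u hu
    have hu0 : 0 < u := lt_trans zero_lt_one hu
    rw [Real.norm_of_nonneg (mul_nonneg (by linarith [Real.cos_le_one (x * u)])
      (Real.rpow_nonneg hu0.le _))]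
    exact mul_le_mul_of_nonneg_right (by linarith [Real.neg_one_le_cos (x * u)])
      (Real.rpow_nonneg hu0.le _)

/-- The harmonisable representation of `|x| ^ (2 * H)`, up to a constant. -/
theorem integral_one_sub_cos_mul_rpow {H : ℝ} (hH : H ∈ Set.Ioo (0 : ℝ) 1) (x : ℝ) :
    ∫ u in Set.Ioi (0 : ℝ), (1 - Real.cos (x * u)) * u ^ (-1 - 2 * H)
      = |x| ^ (2 * H) * ∫ u in Set.Ioi (0 : ℝ), (1 - Real.cos u) * u ^ (-1 - 2 * H) := by
  rcases eq_or_ne x 0 with rfl | hx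
  · simp [Real.zero_rpow (by linarith [hH.1] : 2 * H ≠ 0)]
  have hx' : 0 < |x| := abs_pos.2 hx
  have h := integral_comp_mul_left_Ioi' (fun u => (1 - Real.cos u) * u ^ (-1 - 2 * H)) 0 hx'
  rw [mul_zero] at h
  rw [← h, smul_eq_mul, ← mul_assoc, ← integral_const_mul]
  refine setIntegral_congr_fun measurableSet_Ioi fun u hu => ?_
  have hu0 : 0 < u := hu
  have hcos : Real.cos (|x| * u) = Real.cos (x * u) := by
    rw [← Real.cos_abs (x * u), abs_mul, abs_of_pos hu0]
  have hpow : |x| ^ (2 * H) * |x| * |x| ^ (-1 - 2 * H) = 1 := by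
    nth_rewrite 2 [← Real.rpow_one |x|]
    rw [← Real.rpow_add hx', ← Real.rpow_add hx']
    ring_nf
    exact Real.rpow_zero _
  simp only [hcos, Real.mul_rpow hx'.le hu0.le]
  linear_combination (-(1 - Real.cos (x * u)) * u ^ (-1 - 2 * H)) * hpow

theorem cos_lt_one_of_mem_Ioo {u : ℝ} (hu : u ∈ Set.Ioo (0 : ℝ) 1) : Real.cos u < 1 := by
  simpa using Real.cos_lt_cos_of_nonneg_of_le_pi le_rfl (by linarith [hu.2, Real.pi_gt_three]) hu.1

theorem integral_one_sub_cos_mul_rpow_pos {H : ℝ} (hH : H ∈ Set.Ioo (0 : ℝ) 1) :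
    0 < ∫ u in Set.Ioi (0 : ℝ), (1 - Real.cos u) * u ^ (-1 - 2 * H) := by
  have hint := integrableOn_one_sub_cos_mul_rpow hH 1
  simp only [one_mul] at hint
  have hnn : ∀ u ∈ Set.Ioi (0 : ℝ), 0 ≤ (1 - Real.cos u) * u ^ (-1 - 2 * H) := fun u hu =>
    mul_nonneg (by linarith [Real.cos_le_one u]) (Real.rpow_nonneg (le_of_lt hu) _)
  rw [setIntegral_pos_iff_support_of_nonneg_ae
    ((ae_restrict_mem measurableSet_Ioi).mono hnn) hint]
  refine lt_of_lt_of_le ?_ (measure_mono (s := Set.Ioo (0 : ℝ) 1) ?_)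
  · simp
  intro u hu
  refine ⟨mul_ne_zero ?_ (Real.rpow_pos_of_pos hu.1 _).ne', hu.1⟩
  have := cos_lt_one_of_mem_Ioo hu
  linarith

/-- Spectral representation of the fractional Gaussian noise covariance. -/
theorem SigmaH_mul_integral {H : ℝ} (hH : H ∈ Set.Ioo (0 : ℝ) 1) (δ : ℝ) (N : ℕ) (i j : Fin N) :
    SigmaH H δ N i j * ∫ u in Set.Ioi (0 : ℝ), (1 - Real.cos u) * u ^ (-1 - 2 * H)
      = δ ^ (2 * H) * ∫ u in Set.Ioi (0 : ℝ),
          Real.cos (((i : ℝ) - j) * u) * ((1 - Real.cos u) * u ^ (-1 - 2 * H)) := by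
  have hi := fun x => integrableOn_one_sub_cos_mul_rpow hH x
  have key : ∫ u in Set.Ioi (0 : ℝ),
      2 * (Real.cos (((i : ℝ) - j) * u) * ((1 - Real.cos u) * u ^ (-1 - 2 * H)))
      = ∫ u in Set.Ioi (0 : ℝ),
        ((1 - Real.cos (((i : ℝ) - j + 1) * u)) * u ^ (-1 - 2 * H)
          + (1 - Real.cos (((i : ℝ) - j - 1) * u)) * u ^ (-1 - 2 * H)
          - 2 * ((1 - Real.cos (((i : ℝ) - j) * u)) * u ^ (-1 - 2 * H))) := by
    congr 1
    ext u
    rw [add_mul ((i : ℝ) - j), sub_mul ((i : ℝ) - j), one_mul, Real.cos_add, Real.cos_sub]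
    ring
  have hadd : IntegrableOn (fun u : ℝ =>
      (1 - Real.cos (((i : ℝ) - j + 1) * u)) * u ^ (-1 - 2 * H)
        + (1 - Real.cos (((i : ℝ) - j - 1) * u)) * u ^ (-1 - 2 * H)) (Set.Ioi 0) :=
    (hi _).add (hi _)
  rw [integral_const_mul, integral_sub hadd ((hi _).const_mul _),
    integral_add (hi _) (hi _), integral_const_mul, integral_one_sub_cos_mul_rpow hH,
    integral_one_sub_cos_mul_rpow hH, integral_one_sub_cos_mul_rpow hH] at key
  simp only [SigmaH]
  linear_combination (-δ ^ (2 * H) / 2) * key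

theorem sum_sum_mul_cos_sub {N : ℕ} (a : Fin N → ℝ) (u : ℝ) :
    ∑ i, ∑ j, a i * a j * Real.cos (((i : ℝ) - j) * u)
      = (∑ i, a i * Real.cos (i * u)) ^ 2 + (∑ i, a i * Real.sin (i * u)) ^ 2 := by
  simp_rw [sq, Finset.sum_mul_sum, ← Finset.sum_add_distrib]
  refine Finset.sum_congr rfl fun i _ => Finset.sum_congr rfl fun j _ => ?_
  rw [sub_mul, Real.cos_sub]
  ring

/-- A trigonometric polynomial with infinitely many zeros in `(0, 1)` is zero. -/
theorem eq_zero_of_infinite_zeros {N : ℕ} (a : Fin N → ℝ) {S : Set ℝ} (hS : S.Infinite)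
    (hS1 : S ⊆ Set.Ioo 0 1)
    (h : ∀ u ∈ S, (∑ i, a i * Real.cos (i * u)) ^ 2 + (∑ i, a i * Real.sin (i * u)) ^ 2 = 0) :
    a = 0 := by
  let p : Polynomial ℂ := ∑ i : Fin N, Polynomial.monomial (i : ℕ) (a i : ℂ)
  have hinj : Set.InjOn (fun u : ℝ => Complex.exp (u * Complex.I)) S := by
    intro u hu v hv huv
    have h1 := congrArg Complex.re huv
    simp only [Complex.exp_ofReal_mul_I_re] at h1
    have hpi := Real.pi_gt_three
    exact Real.injOn_cos ⟨(hS1 hu).1.le, by linarith [(hS1 hu).2]⟩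
      ⟨(hS1 hv).1.le, by linarith [(hS1 hv).2]⟩ h1
  have hp : p = 0 := by
    refine Polynomial.eq_zero_of_infinite_isRoot p ((hS.image hinj).mono ?_)
    rintro _ ⟨u, hu, rfl⟩
    have hz : ∀ i : Fin N, Complex.exp (u * Complex.I) ^ (i : ℕ)
        = Complex.exp (((i : ℝ) * u : ℝ) * Complex.I) := fun i => by
      rw [← Complex.exp_nat_mul]
      push_cast
      ring_nf
    have hre := (add_eq_zero_iff_of_nonneg (sq_nonneg _) (sq_nonneg _)).1 (h u hu)
    simp only [Set.mem_ofPred_eq, Polynomial.IsRoot.def, p, Polynomial.eval_finsetSum,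
      Polynomial.eval_monomial, hz]
    apply Complex.ext
    · simpa [Complex.exp_ofReal_mul_I_re, Complex.exp_ofReal_mul_I_im, -Complex.ofReal_mul]
        using hre.1
    · simpa [Complex.exp_ofReal_mul_I_re, Complex.exp_ofReal_mul_I_im, -Complex.ofReal_mul]
        using hre.2
  ext i
  have hc := congrArg (fun q => Polynomial.coeff q (i : ℕ)) hp
  simpa [p, Polynomial.finsetSum_coeff, Polynomial.coeff_monomial, Fin.val_inj] using hc

theorem posDef_SigmaH {H δ : ℝ} (hH : H ∈ Set.Ioo (0 : ℝ) 1) (hδ : 0 < δ) (N : ℕ) :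
    (SigmaH H δ N).PosDef := by
  have hC := integral_one_sub_cos_mul_rpow_pos hH
  have hwint := integrableOn_one_sub_cos_mul_rpow hH 1
  simp only [one_mul] at hwint
  refine PosDef.of_dotProduct_mulVec_pos ?_ fun a ha => ?_
  · ext i j
    simp only [conjTranspose_apply, star_trivial, SigmaH]
    rw [abs_sub_comm (j : ℝ) i,
      show (j : ℝ) - i + 1 = -((i : ℝ) - j - 1) by ring,
      show (j : ℝ) - i - 1 = -((i : ℝ) - j + 1) by ring, abs_neg, abs_neg]
    ring
  have hint : ∀ d : ℝ, IntegrableOn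
      (fun u => Real.cos (d * u) * ((1 - Real.cos u) * u ^ (-1 - 2 * H))) (Set.Ioi (0 : ℝ)) :=
    fun d => hwint.bdd_mul (c := 1) (by fun_prop)
      (ae_of_all _ fun u => by simpa using Real.abs_cos_le_one (d * u))
  have hquad : (star a ⬝ᵥ (SigmaH H δ N *ᵥ a)) *
      ∫ u in Set.Ioi (0 : ℝ), (1 - Real.cos u) * u ^ (-1 - 2 * H)
      = δ ^ (2 * H) * ∫ u in Set.Ioi (0 : ℝ),
        ((∑ i, a i * Real.cos (i * u)) ^ 2 + (∑ i, a i * Real.sin (i * u)) ^ 2)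
          * ((1 - Real.cos u) * u ^ (-1 - 2 * H)) := by
    simp_rw [← sum_sum_mul_cos_sub, Finset.sum_mul, mul_assoc]
    rw [integral_finsetSum _ fun i _ => integrable_finsetSum _ fun j _ =>
      ((hint _).const_mul _).const_mul _]
    simp_rw [integral_finsetSum _ fun j _ => ((hint _).const_mul _).const_mul _,
      integral_const_mul, Finset.mul_sum, dotProduct, mulVec, dotProduct, Finset.mul_sum,
      Finset.sum_mul]
    refine Finset.sum_congr rfl fun i _ => Finset.sum_congr rfl fun j _ => ?_
    have := SigmaH_mul_integral hH δ N i j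
    simp only [Pi.star_apply, star_trivial]
    linear_combination a i * a j * this
  refine pos_of_mul_pos_left ?_ hC.le
  rw [hquad]
  have hfint : IntegrableOn (fun u : ℝ =>
        ((∑ i, a i * Real.cos (i * u)) ^ 2 + (∑ i, a i * Real.sin (i * u)) ^ 2)
          * ((1 - Real.cos u) * u ^ (-1 - 2 * H))) (Set.Ioi (0 : ℝ)) := by
    simp_rw [← sum_sum_mul_cos_sub, Finset.sum_mul, mul_assoc]
    exact integrable_finsetSum _ fun i _ => integrable_finsetSum _ fun j _ =>
      ((hint _).const_mul _).const_mul _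
  have hnn : 0 ≤ᵐ[volume.restrict (Set.Ioi (0 : ℝ))] fun u : ℝ =>
        ((∑ i, a i * Real.cos (i * u)) ^ 2 + (∑ i, a i * Real.sin (i * u)) ^ 2)
          * ((1 - Real.cos u) * u ^ (-1 - 2 * H)) := by
    filter_upwards [ae_restrict_mem measurableSet_Ioi] with u hu
    exact mul_nonneg (by positivity) (mul_nonneg (by linarith [Real.cos_le_one u])
      (Real.rpow_nonneg (le_of_lt hu) _))
  refine mul_pos (Real.rpow_pos_of_pos hδ _) ((integral_nonneg_of_ae hnn).lt_of_ne' ?_)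
  intro hzero
  rw [integral_eq_zero_iff_of_nonneg_ae hnn hfint] at hzero
  refine ha (eq_zero_of_infinite_zeros a
    (S := {u ∈ Set.Ioo (0 : ℝ) 1 |
      (∑ i, a i * Real.cos (i * u)) ^ 2 + (∑ i, a i * Real.sin (i * u)) ^ 2 = 0}) ?_
    (fun u hu => hu.1) fun u hu => hu.2)
  intro hfin
  have hae : ∀ᵐ u : ℝ, u ∉ Set.Ioo (0 : ℝ) 1 := by
    filter_upwards [(ae_restrict_iff' measurableSet_Ioi).1 hzero,
      measure_eq_zero_iff_ae_notMem.1 (hfin.measure_zero volume)] with u h1 h2 hu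
    refine h2 ⟨hu, ?_⟩
    refine (mul_eq_zero.1 (h1 hu.1)).resolve_right (mul_ne_zero ?_
      (Real.rpow_pos_of_pos hu.1 _).ne')
    have := cos_lt_one_of_mem_Ioo hu
    linarith
  have := measure_eq_zero_iff_ae_notMem.2 hae
  simp at this

theorem fbmCov_increments_eq_SigmaH {H δ : ℝ} (hδ : 0 ≤ δ) (N : ℕ) (i j : Fin N) :
    fbmCov H (((i : ℕ) + 1 : ℝ) * δ) (((j : ℕ) + 1 : ℝ) * δ)
      - fbmCov H (((i : ℕ) + 1 : ℝ) * δ) ((j : ℕ) * δ)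
      - fbmCov H ((i : ℕ) * δ) (((j : ℕ) + 1 : ℝ) * δ)
      + fbmCov H ((i : ℕ) * δ) ((j : ℕ) * δ) = SigmaH H δ N i j := by
  have hpow : ∀ x : ℝ, |x * δ| ^ (2 * H) = |x| ^ (2 * H) * δ ^ (2 * H) := fun x => by
    rw [abs_mul, abs_of_nonneg hδ, Real.mul_rpow (abs_nonneg x) hδ]
  simp only [fbmCov, SigmaH, ← sub_mul, hpow]
  rw [show (i : ℝ) + 1 - (j + 1) = i - j by ring, show (i : ℝ) + 1 - j = i - j + 1 by ring,
    show (i : ℝ) - (j + 1) = i - j - 1 by ring]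
  ring

/-- The increments of fractional Brownian motion over a grid in `[0, T]` form a centered Gaussian
vector with covariance matrix `SigmaH`. -/
theorem IsFBMOn.map_dotProduct_increments {Ω : Type*} [MeasureSpace Ω] {H T δ : ℝ}
    {B : ℝ → Ω → ℝ} (hB : IsFBMOn H T B) (hδ : 0 ≤ δ) (N : ℕ) (hT : N * δ ≤ T)
    (a : Fin N → ℝ) :
    Measure.map (fun ω => a ⬝ᵥ
        fun k : Fin N => B (((k : ℕ) + 1 : ℝ) * δ) ω - B ((k : ℕ) * δ) ω) (ℙ : Measure Ω)
      = gaussianReal 0 (a ⬝ᵥ (SigmaH H δ N *ᵥ a)).toNNReal := by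
  have hmem : ∀ x : ℝ, 0 ≤ x → x ≤ N → x * δ ∈ Set.Icc 0 T := fun x h0 h1 =>
    ⟨mul_nonneg h0 hδ, (mul_le_mul_of_nonneg_right h1 hδ).trans hT⟩
  have hlt : ∀ k : Fin N, ((k : ℕ) : ℝ) + 1 ≤ N := fun k => by exact_mod_cast k.2
  have h := hB.gaussian (N + N)
    (Fin.append (fun k : Fin N => ((k : ℕ) + 1 : ℝ) * δ) (fun k : Fin N => (k : ℕ) * δ))
    (fun i => by
      refine Fin.addCases (fun k => ?_) (fun k => ?_) i
      · rw [Fin.append_left]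
        exact hmem _ (by positivity) (hlt k)
      · rw [Fin.append_right]
        exact hmem _ (by positivity) (by linarith [hlt k]))
    (Fin.append a (-a))
  simp only [Fin.sum_univ_add, Fin.append_left, Fin.append_right, Pi.neg_apply] at h
  convert h using 2
  · ext ω
    simp only [dotProduct, ← Finset.sum_add_distrib]
    exact Finset.sum_congr rfl fun k _ => by ring
  · congr 1
    simp only [dotProduct, mulVec, ← fbmCov_increments_eq_SigmaH hδ, Finset.mul_sum,
      ← Finset.sum_add_distrib]
    exact Finset.sum_congr rfl fun i _ => Finset.sum_congr rfl fun j _ => by ring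

/-- Strong law for normalised chi-squared variables with growing degrees of freedom, without any
assumption on the joint law. -/
theorem ae_tendsto_of_map_eq_pi_gaussianReal {Ω : Type*} [MeasurableSpace Ω] {μ : Measure Ω}
    [IsProbabilityMeasure μ] {Q : ℕ → Ω → ℝ}
    (hQ : ∀ N : ℕ, 0 < N → ∃ Z : Ω → Fin N → ℝ, Measurable Z ∧
      μ.map Z = Measure.pi (fun _ => gaussianReal 0 1) ∧ ∀ ω, Q N ω = ∑ i, Z ω i ^ 2) :
    ∀ᵐ ω ∂μ, Tendsto (fun N : ℕ => 1 / (N : ℝ) * Q N ω) atTop (𝓝 1) := by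
  have hbound : ∀ (ε : ℝ), 0 < ε → ε ≤ 1 → ∀ N : ℕ,
      μ {ω | ε * N ≤ |Q N ω - N|} ≤ ENNReal.ofReal (2 * Real.exp (-(ε ^ 2 / 8)) ^ N) := by
    intro ε hε hε1 N
    rcases N.eq_zero_or_pos with rfl | hN
    · refine prob_le_one.trans ?_
      simp
    obtain ⟨Z, hZ, hmap, hQZ⟩ := hQ N hN
    rw [← ofReal_measureReal]
    refine ENNReal.ofReal_le_ofReal ?_
    refine le_of_eq_of_le ?_ (measureReal_abs_sum_sq_sub_ge_le N hε hε1)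
    rw [← hmap, map_measureReal_apply hZ (measurableSet_le (by fun_prop) (by fun_prop))]
    simp only [hQZ]
    rfl
  have hev : ∀ m : ℕ, ∀ᵐ ω ∂μ, ∀ᶠ N : ℕ in atTop,
      |Q N ω - N| < 1 / ((m : ℝ) + 1) * N := by
    intro m
    have hε : 0 < 1 / ((m : ℝ) + 1) := by positivity
    have hε1 : 1 / ((m : ℝ) + 1) ≤ 1 := by
      rw [div_le_one (by positivity)]
      linarith [(Nat.cast_nonneg m : (0 : ℝ) ≤ m)]
    have hsum : Summable fun N : ℕ => 2 * Real.exp (-((1 / ((m : ℝ) + 1)) ^ 2 / 8)) ^ N :=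
      (summable_geometric_of_lt_one (Real.exp_pos _).le
        (Real.exp_lt_one_iff.2 (neg_lt_zero.2 (by positivity)))).mul_left 2
    have := ae_eventually_notMem (μ := μ)
      (s := fun N : ℕ => {ω | 1 / ((m : ℝ) + 1) * N ≤ |Q N ω - N|})
      (ne_top_of_le_ne_top hsum.tsum_ofReal_ne_top (ENNReal.tsum_le_tsum (hbound _ hε hε1)))
    filter_upwards [this] with ω hω
    filter_upwards [hω] with N hN
    exact not_le.1 hN
  filter_upwards [ae_all_iff.2 hev] with ω hω
  refine Metric.tendsto_atTop'.2 fun ε hε => ?_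
  obtain ⟨m, hm⟩ := exists_nat_one_div_lt hε
  obtain ⟨n, hn⟩ := eventually_atTop.1 (hω m)
  refine ⟨n, fun N hN => ?_⟩
  have hN0 : 0 < (N : ℝ) := by exact_mod_cast (Nat.zero_le n).trans_lt hN
  rw [Real.dist_eq, show 1 / (N : ℝ) * Q N ω - 1 = (Q N ω - N) / N by field_simp, abs_div,
    abs_of_pos hN0, div_lt_iff₀ hN0]
  exact (hn N hN.le).trans (mul_lt_mul_of_pos_right hm hN0)

theorem phiDelta_pos {δ θ : ℝ} (hδ : 0 < δ) (hθ : 0 < θ) : 0 < phiDelta δ θ :=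
  div_pos (sub_pos.2 (Real.exp_lt_one_iff.2 (neg_lt_zero.2 (mul_pos hθ hδ)))) (mul_pos hθ hδ)

theorem deltaVec_xrec (θ₀ σ₀ δ x₀ : ℝ) (b : ℕ → ℝ) (N : ℕ) :
    deltaVec θ₀ δ (xrec θ₀ σ₀ δ x₀ b) N = (σ₀ * phiDelta δ θ₀) • fun k : Fin N => b ((k : ℕ) + 1) := by
  ext k
  simp only [deltaVec, xrec, Pi.smul_apply, smul_eq_mul]
  ring

/-- The `σ`-score at the true parameters, for data generated recursively from the driver `b`. -/
theorem hasDerivAt_rescaled_loglik_xrec {H T δ θ₀ σ₀ : ℝ} (hδ : 0 < δ) (hθ₀ : 0 < θ₀)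
    (hσ₀ : 0 < σ₀) {N : ℕ} (hT : N * δ = T) (x₀ : ℝ) (b : ℕ → ℝ) :
    HasDerivAt (fun σ => δ * loglik H δ N (xrec θ₀ σ₀ δ x₀ b) θ₀ σ)
      (δ / σ₀ * ((fun k : Fin N => b ((k : ℕ) + 1)) ⬝ᵥ
        ((SigmaH H δ N)⁻¹ *ᵥ fun k : Fin N => b ((k : ℕ) + 1))) - T / σ₀) σ₀ := by
  have hφ := phiDelta_pos hδ hθ₀
  simp only [loglik, deltaVec_xrec, mulVec_smul, smul_dotProduct, dotProduct_smul, smul_eq_mul]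
  generalize (fun k : Fin N => b ((k : ℕ) + 1)) ⬝ᵥ
    ((SigmaH H δ N)⁻¹ *ᵥ fun k : Fin N => b ((k : ℕ) + 1)) = q
  generalize phiDelta δ θ₀ = φ at hφ
  have h1 : HasDerivAt (fun σ : ℝ => 2 * σ ^ 2 * φ ^ 2) (4 * σ₀ * φ ^ 2) σ₀ :=
    (((hasDerivAt_pow 2 σ₀).const_mul 2).mul_const (φ ^ 2)).congr_deriv (by push_cast; ring)
  have h2 : HasDerivAt (fun σ : ℝ => Real.log (σ * φ)) (φ / (σ₀ * φ)) σ₀ := by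
    simpa using ((hasDerivAt_id σ₀).mul_const φ).log (by simpa using (mul_pos hσ₀ hφ).ne')
  have h3 := (((h1.inv (by positivity)).neg.mul_const (σ₀ * φ * (σ₀ * φ * q))).sub
    (h2.const_mul (N : ℝ))).const_mul δ
  refine (h3.congr_deriv ?_).congr_of_eventuallyEq (.of_eq ?_)
  · rw [← hT]
    field_simp
    ring
  · ext σ
    simp

/-- Almost-sure vanishing, as `δ = T/N → 0`, of the `σ`-derivative of the rescaled
log-likelihood at the true parameters, when the data are generated from fractional
Brownian motion increments; equivalently, `(1/N) bᵀ (Σ^H_{δ,N})⁻¹ b → 1` a.s. -/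
theorem deriv_sigma_rescaled_loglik_tendsto_zero
    {Ω : Type*} [MeasureSpace Ω] [IsProbabilityMeasure (ℙ : Measure Ω)]
    (H T θ₀ σ₀ : ℝ) (hH : H ∈ Set.Ioo (0 : ℝ) 1) (hT : 0 < T)
    (hθ₀ : 0 < θ₀) (hσ₀ : 0 < σ₀)
    (B : ℝ → Ω → ℝ) (hB : IsFBMOn H T B) (x₀ : ℝ) :
    ∀ᵐ ω : Ω,
      Tendsto
        (fun N : ℕ =>
          deriv
            (fun σ => (T / N) * loglik H (T / N) N
              (xrec θ₀ σ₀ (T / N) x₀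
                (fun k => B ((k : ℝ) * (T / N)) ω - B (((k : ℝ) - 1) * (T / N)) ω)) θ₀ σ)
            σ₀)
        atTop (𝓝 0) ∧
      Tendsto
        (fun N : ℕ =>
          (1 / (N : ℝ)) *
            ((fun k : Fin N => B (((k : ℕ) + 1 : ℝ) * (T / N)) ω - B ((k : ℕ) * (T / N)) ω) ⬝ᵥ
              ((SigmaH H (T / N) N)⁻¹ *ᵥ
                fun k : Fin N => B (((k : ℕ) + 1 : ℝ) * (T / N)) ω - B ((k : ℕ) * (T / N)) ω)))
        atTop (𝓝 1) := by
  set b : ℕ → Ω → ℕ → ℝ := fun N ω k =>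
    B ((k : ℝ) * (T / N)) ω - B (((k : ℝ) - 1) * (T / N)) ω with hb
  have hincr : ∀ (N : ℕ) (ω : Ω), (fun k : Fin N =>
      B (((k : ℕ) + 1 : ℝ) * (T / N)) ω - B ((k : ℕ) * (T / N)) ω) = fun k : Fin N => b N ω ((k : ℕ) + 1) :=
    fun N ω => by
      ext k
      simp [hb]
  have hδ : ∀ N : ℕ, 0 < N → 0 < T / N ∧ N * (T / N) = T := fun N hN => by
    have : 0 < (N : ℝ) := by exact_mod_cast hN
    exact ⟨by positivity, by field_simp⟩
  have hlim := ae_tendsto_of_map_eq_pi_gaussianReal (μ := (ℙ : Measure Ω))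
    (Q := fun N ω =>
      (fun k : Fin N => B (((k : ℕ) + 1 : ℝ) * (T / N)) ω - B ((k : ℕ) * (T / N)) ω) ⬝ᵥ
        ((SigmaH H (T / N) N)⁻¹ *ᵥ
          fun k : Fin N => B (((k : ℕ) + 1 : ℝ) * (T / N)) ω - B ((k : ℕ) * (T / N)) ω))
    fun N hN => exists_map_eq_pi_gaussianReal (posDef_SigmaH hH (hδ N hN).1 N)
      (measurable_pi_lambda _ fun k => (hB.meas _).sub (hB.meas _))
      (hB.map_dotProduct_increments (hδ N hN).1.le N (hδ N hN).2.le)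
  filter_upwards [hlim] with ω hω
  refine ⟨?_, hω⟩
  have h0 : Tendsto (fun N : ℕ => T / σ₀ * (1 / (N : ℝ) *
      ((fun k : Fin N => B (((k : ℕ) + 1 : ℝ) * (T / N)) ω - B ((k : ℕ) * (T / N)) ω) ⬝ᵥ
        ((SigmaH H (T / N) N)⁻¹ *ᵥ
          fun k : Fin N => B (((k : ℕ) + 1 : ℝ) * (T / N)) ω - B ((k : ℕ) * (T / N)) ω)) - 1))
      atTop (𝓝 0) := by
    simpa using (hω.sub_const 1).const_mul (T / σ₀)
  refine h0.congr' ?_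
  filter_upwards [eventually_gt_atTop 0] with N hN
  have hN' : (N : ℝ) ≠ 0 := by exact_mod_cast hN.ne'
  rw [(hasDerivAt_rescaled_loglik_xrec (hδ N hN).1 hθ₀ hσ₀ (hδ N hN).2 x₀ (b N ω)).deriv, hincr]
  field_simp
end
end

section
/- Let ε > 0, σ > 0, and let (Y_t)_{t≥0} be a centered Gaussian process with almost surely continuous sample paths and covariance E[Y_s Y_u] = (σ²/2) e^{−|s−u|/ε} (the stationary Ornstein–Uhlenbeck process with relaxation time ε driven by Brownian motion). Define X^ε_t = ε^{−1/2} ∫_0^t Y_s ds, and for N ∈ ℕ, δ > 0, T = Nδ, the quadratic-variation estimator σ̂²_{ε,δ} = (1/T) Σ_{i=1}^{N} (X^ε_{iδ} − X^ε_{(i−1)δ})². Then E[σ̂²_{ε,δ}] = σ² ( 1 + (ε/δ)(e^{−δ/ε} − 1) ). Consequently, along any sequences ε_n, δ_n > 0 with ε_n/δ_n → 0 one has E[σ̂²_{ε_n,δ_n}] → σ², whereas if ε_n/δ_n → ∞ then E[σ̂²_{ε_n,δ_n}] → 0. -/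
open MeasureTheory ProbabilityTheory Filter Topology

noncomputable section

/-- The slow component `X^ε_t = ε^{−1/2} ∫_0^t Y_s ds` of the physical Brownian motion
(kinetic) model. -/
def slowKin {Ω : Type*} [MeasureSpace Ω] (Y : ℝ → ℝ → Ω → ℝ) (ε t : ℝ) (ω : Ω) : ℝ :=
  ε ^ (-(1 / 2) : ℝ) * ∫ s in (0 : ℝ)..t, Y ε s ω

/-- The quadratic-variation estimator
`σ̂²_{ε,δ} = (1/T) Σ_{i=1}^N (X^ε_{iδ} − X^ε_{(i−1)δ})²` with `T = Nδ`. -/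
def qvEst {Ω : Type*} [MeasureSpace Ω] (Y : ℝ → ℝ → Ω → ℝ) (ε δ : ℝ) (N : ℕ) (ω : Ω) : ℝ :=
  (1 / ((N : ℝ) * δ)) *
    ∑ i ∈ Finset.range N,
      (slowKin Y ε (((i : ℝ) + 1) * δ) ω - slowKin Y ε ((i : ℝ) * δ) ω) ^ 2

section SecondMoment

variable {Ω : Type*} [MeasurableSpace Ω] {P : Measure Ω}

theorem memLp_two_of_map_eq_gaussianReal {f : Ω → ℝ} (hf : Measurable f) {v : NNReal}
    (h : P.map f = gaussianReal 0 v) : MemLp f 2 P := by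
  have := memLp_id_gaussianReal (μ := 0) (v := v) 2
  rw [← h] at this
  exact (memLp_map_measure_iff (by fun_prop) hf.aemeasurable).1 this

theorem integral_sq_of_map_eq_gaussianReal {f : Ω → ℝ} (hf : Measurable f) {v : NNReal}
    (h : P.map f = gaussianReal 0 v) : ∫ ω, f ω ^ 2 ∂P = v := by
  have h1 : ∫ x, x ^ 2 ∂(P.map f) = ∫ ω, f ω ^ 2 ∂P :=
    integral_map hf.aemeasurable (by fun_prop)
  have h2 := variance_id_gaussianReal (μ := 0) (v := v)
  rw [variance_eq_integral (by fun_prop)] at h2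
  simp only [id, integral_id_gaussianReal, sub_zero] at h2
  rw [← h1, h, h2]

/-- The second moments of a process with bounded variance are integrable over pairs of times. -/
theorem integrable_mul_of_integral_sq_le [SFinite P] {μ : Measure ℝ} [IsFiniteMeasure μ]
    {Z : ℝ → Ω → ℝ} (hZ : Measurable (Function.uncurry Z)) (hL : ∀ s, MemLp (Z s) 2 P) {v : ℝ}
    (hv : ∀ s, ∫ ω, Z s ω ^ 2 ∂P ≤ v) :
    Integrable (fun p : (ℝ × ℝ) × Ω => Z p.1.1 p.2 * Z p.1.2 p.2) ((μ.prod μ).prod P) := by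
  have m1 : Measurable fun p : (ℝ × ℝ) × Ω => Z p.1.1 p.2 :=
    hZ.comp (by fun_prop : Measurable fun p : (ℝ × ℝ) × Ω => (p.1.1, p.2))
  have m2 : Measurable fun p : (ℝ × ℝ) × Ω => Z p.1.2 p.2 :=
    hZ.comp (by fun_prop : Measurable fun p : (ℝ × ℝ) × Ω => (p.1.2, p.2))
  have m := m1.mul m2
  have hi : ∀ s u, Integrable (fun ω => Z s ω * Z u ω) P := fun s u => (hL s).integrable_mul (hL u)
  refine (integrable_prod_iff m.aestronglyMeasurable).2
    ⟨.of_forall fun p => hi p.1 p.2, ?_⟩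
  refine Integrable.mono' (integrable_const v)
    m.norm.stronglyMeasurable.integral_prod_right.aestronglyMeasurable (.of_forall fun p => ?_)
  rw [Real.norm_of_nonneg (integral_nonneg fun _ => norm_nonneg _)]
  have i1 := (hL p.1).integrable_sq
  have i2 := (hL p.2).integrable_sq
  calc ∫ ω, ‖Z p.1 ω * Z p.2 ω‖ ∂P
      ≤ ∫ ω, (1 / 2 * Z p.1 ω ^ 2 + 1 / 2 * Z p.2 ω ^ 2) ∂P := by
        refine integral_mono (hi p.1 p.2).norm ((i1.const_mul _).add (i2.const_mul _)) fun ω => ?_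
        simp only [Real.norm_eq_abs, abs_mul]
        nlinarith [sq_nonneg (|Z p.1 ω| - |Z p.2 ω|), sq_abs (Z p.1 ω), sq_abs (Z p.2 ω)]
    _ ≤ v := by
        rw [integral_add (i1.const_mul _) (i2.const_mul _), integral_const_mul, integral_const_mul]
        linarith [hv p.1, hv p.2]

theorem integrable_sq_integral [SFinite P] {μ : Measure ℝ} [IsFiniteMeasure μ]
    {Z : ℝ → Ω → ℝ} (hZ : Measurable (Function.uncurry Z)) (hL : ∀ s, MemLp (Z s) 2 P) {v : ℝ}
    (hv : ∀ s, ∫ ω, Z s ω ^ 2 ∂P ≤ v) :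
    Integrable (fun ω => (∫ s, Z s ω ∂μ) ^ 2) P := by
  refine (integrable_mul_of_integral_sq_le (μ := μ) hZ hL hv).integral_prod_right.congr
    (.of_forall fun ω => ?_)
  simp only [sq]
  exact integral_prod_mul (fun s => Z s ω) (fun u => Z u ω)

theorem integral_sq_integral [SFinite P] {μ : Measure ℝ} [IsFiniteMeasure μ]
    {Z : ℝ → Ω → ℝ} (hZ : Measurable (Function.uncurry Z)) (hL : ∀ s, MemLp (Z s) 2 P) {v : ℝ}
    (hv : ∀ s, ∫ ω, Z s ω ^ 2 ∂P ≤ v) :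
    ∫ ω, (∫ s, Z s ω ∂μ) ^ 2 ∂P = ∫ s, ∫ u, ∫ ω, Z s ω * Z u ω ∂P ∂μ ∂μ := by
  have hint := integrable_mul_of_integral_sq_le (μ := μ) hZ hL hv
  calc ∫ ω, (∫ s, Z s ω ∂μ) ^ 2 ∂P
      = ∫ ω, ∫ p, Z p.1 ω * Z p.2 ω ∂(μ.prod μ) ∂P := by
        refine integral_congr_ae (.of_forall fun ω => ?_)
        simp only [sq]
        exact (integral_prod_mul (fun s => Z s ω) (fun u => Z u ω)).symm
    _ = ∫ p, ∫ ω, Z p.1 ω * Z p.2 ω ∂P ∂(μ.prod μ) :=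
        (integral_integral_swap (f := fun (p : ℝ × ℝ) ω => Z p.1 ω * Z p.2 ω) hint).symm
    _ = _ := integral_prod _ hint.integral_prod_left

/-- A process with almost surely continuous paths on `[0, ∞)` agrees there, outside a null set,
with a process indexed by `ℝ` all of whose paths are continuous. -/
theorem exists_continuous_modification {Y : ℝ → Ω → ℝ} (hY : ∀ t, Measurable (Y t))
    (hc : ∀ᵐ ω ∂P, ContinuousOn (fun t => Y t ω) (Set.Ici 0)) :
    ∃ Z : ℝ → Ω → ℝ, Measurable (Function.uncurry Z) ∧ (∀ ω, Continuous fun t => Z t ω) ∧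
      ∀ᵐ ω ∂P, ∀ t, Z t ω = Y (max t 0) ω := by
  classical
  obtain ⟨B, hB, hBm, hBP⟩ := exists_measurable_superset_of_null (ae_iff.1 hc)
  have hZc : ∀ ω, Continuous fun t => if ω ∈ B then 0 else Y (max t 0) ω := by
    intro ω
    by_cases hω : ω ∈ B
    · simpa [hω] using continuous_const
    · have : ContinuousOn (fun t => Y t ω) (Set.Ici 0) := by
        by_contra h
        exact hω (hB h)
      simp only [hω, if_false]
      exact this.comp_continuous (f := fun t : ℝ => max t 0) (by fun_prop)
        fun t => le_max_right t 0
  refine ⟨fun t ω => if ω ∈ B then 0 else Y (max t 0) ω, ?_, hZc, ?_⟩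
  · exact (measurable_uncurry_of_continuous_of_measurable
      (u := fun t ω => if ω ∈ B then 0 else Y (max t 0) ω) hZc
      fun t => Measurable.ite hBm measurable_const (hY _))
  · filter_upwards [measure_eq_zero_iff_ae_notMem.1 hBP] with ω hω t
    simp [hω]

end SecondMoment

section ExponentialKernel

theorem hasDerivAt_mul_exp_neg_sub_div {ε : ℝ} (hε : ε ≠ 0) (a u : ℝ) :
    HasDerivAt (fun u => ε * Real.exp (-(u - a) / ε)) (-Real.exp (-(u - a) / ε)) u := by
  have h : HasDerivAt (fun u => -(u - a) / ε) (-1 / ε) u :=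
    ((hasDerivAt_id' u).sub_const a).fun_neg.div_const ε
  refine (h.exp.const_mul ε).congr_deriv ?_
  field_simp

theorem hasDerivAt_mul_exp_neg_const_sub_div {ε : ℝ} (hε : ε ≠ 0) (b u : ℝ) :
    HasDerivAt (fun u => ε * Real.exp (-(b - u) / ε)) (Real.exp (-(b - u) / ε)) u := by
  have h : HasDerivAt (fun u => -(b - u) / ε) (- -1 / ε) u :=
    ((hasDerivAt_id' u).const_sub b).fun_neg.div_const ε
  refine (h.exp.const_mul ε).congr_deriv ?_
  field_simp

theorem integral_exp_neg_abs_sub_div {ε a b s : ℝ} (hε : 0 < ε) (has : a ≤ s) (hsb : s ≤ b) :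
    ∫ u in a..b, Real.exp (-|s - u| / ε)
      = ε * (2 - Real.exp (-(s - a) / ε) - Real.exp (-(b - s) / ε)) := by
  have hcont : Continuous fun u => Real.exp (-|s - u| / ε) := by fun_prop
  rw [← intervalIntegral.integral_add_adjacent_intervals
    (hcont.intervalIntegrable a s) (hcont.intervalIntegrable s b)]
  have h1 : ∫ u in a..s, Real.exp (-|s - u| / ε) = ε - ε * Real.exp (-(s - a) / ε) := by
    rw [intervalIntegral.integral_congr (g := fun u => Real.exp (-(s - u) / ε)),
      intervalIntegral.integral_eq_sub_of_hasDerivAt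
        (f := fun u => ε * Real.exp (-(s - u) / ε))]
    · simp
    · exact fun u _ => hasDerivAt_mul_exp_neg_const_sub_div hε.ne' s u
    · exact Continuous.intervalIntegrable (by fun_prop) _ _
    · intro u hu
      rw [Set.uIcc_of_le has] at hu
      simp only [abs_of_nonneg (sub_nonneg.2 hu.2)]
  have h2 : ∫ u in s..b, Real.exp (-|s - u| / ε) = ε - ε * Real.exp (-(b - s) / ε) := by
    rw [intervalIntegral.integral_congr (g := fun u => Real.exp (-(u - s) / ε)),
      intervalIntegral.integral_eq_sub_of_hasDerivAt
        (f := fun u => -(ε * Real.exp (-(u - s) / ε)))]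
    · simp; ring
    · intro u _
      simpa using (hasDerivAt_mul_exp_neg_sub_div hε.ne' s u).fun_neg
    · exact Continuous.intervalIntegrable (by fun_prop) _ _
    · intro u hu
      rw [Set.uIcc_of_le hsb] at hu
      simp only [abs_of_nonpos (sub_nonpos.2 hu.1), neg_sub]
  rw [h1, h2]; ring

theorem integral_integral_exp_neg_abs_sub_div {ε a b : ℝ} (hε : 0 < ε) (hab : a ≤ b) :
    ∫ s in a..b, ∫ u in a..b, Real.exp (-|s - u| / ε)
      = 2 * (ε * (b - a) + ε ^ 2 * (Real.exp (-(b - a) / ε) - 1)) := by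
  rw [intervalIntegral.integral_congr
      (g := fun s => ε * (2 - Real.exp (-(s - a) / ε) - Real.exp (-(b - s) / ε))),
    intervalIntegral.integral_eq_sub_of_hasDerivAt
      (f := fun s => ε * (2 * s + ε * Real.exp (-(s - a) / ε) - ε * Real.exp (-(b - s) / ε)))]
  · simp; ring
  · intro s _
    refine (((((hasDerivAt_id' s).const_mul 2).fun_add
      (hasDerivAt_mul_exp_neg_sub_div hε.ne' a s)).fun_sub
      (hasDerivAt_mul_exp_neg_const_sub_div hε.ne' b s)).const_mul ε).congr_deriv ?_
    ring
  · exact Continuous.intervalIntegrable (by fun_prop) _ _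
  · intro s hs
    rw [Set.uIcc_of_le hab] at hs
    exact integral_exp_neg_abs_sub_div hε hs.1 hs.2

end ExponentialKernel

section Limits

theorem tendsto_one_add_mul_exp_neg_inv_sub_one_of_tendsto_zero {x : ℕ → ℝ} (hx : ∀ n, 0 < x n)
    (h : Tendsto x atTop (𝓝 0)) :
    Tendsto (fun n => 1 + x n * (Real.exp (-(x n)⁻¹) - 1)) atTop (𝓝 1) := by
  refine tendsto_of_tendsto_of_tendsto_of_le_of_le (g := fun n => 1 - x n) (h := fun _ => 1)
    (by simpa using h.const_sub 1) tendsto_const_nhds (fun n => ?_) fun n => ?_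
  · nlinarith [hx n, mul_pos (hx n) (Real.exp_pos (-(x n)⁻¹))]
  · have : Real.exp (-(x n)⁻¹) ≤ 1 := Real.exp_le_one_iff.2 (by simpa using (hx n).le)
    nlinarith [hx n]

theorem tendsto_one_add_mul_exp_neg_inv_sub_one_of_tendsto_atTop {x : ℕ → ℝ} (hx : ∀ n, 0 < x n)
    (h : Tendsto x atTop atTop) :
    Tendsto (fun n => 1 + x n * (Real.exp (-(x n)⁻¹) - 1)) atTop (𝓝 0) := by
  refine tendsto_of_tendsto_of_tendsto_of_le_of_le (g := fun _ => 0) (h := fun n => (x n)⁻¹)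
    tendsto_const_nhds h.inv_tendsto_atTop (fun n => ?_) fun n => ?_
  · have h1 := Real.add_one_le_exp (-(x n)⁻¹)
    have h2 : x n * (x n)⁻¹ = 1 := mul_inv_cancel₀ (hx n).ne'
    nlinarith [mul_le_mul_of_nonneg_left h1 (hx n).le]
  · set y := (x n)⁻¹
    have h1 := Real.add_one_le_exp (-y)
    have h2 : x n * y = 1 := mul_inv_cancel₀ (hx n).ne'
    have h3 : (1 + y) * Real.exp (-y) ≤ 1 := by
      calc (1 + y) * Real.exp (-y) ≤ Real.exp y * Real.exp (-y) := by
            gcongr; linarith [Real.add_one_le_exp y]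
        _ = 1 := by rw [← Real.exp_add]; simp
    have h4 := mul_le_mul_of_nonneg_left h3 (hx n).le
    have h5 : x n * ((1 + y) * Real.exp (-y)) = x n * Real.exp (-y) + Real.exp (-y) := by
      linear_combination Real.exp (-y) * h2
    show 1 + x n * (Real.exp (-y) - 1) ≤ y
    linarith

end Limits

/-- The mean square of the integral over `[a, b]` of a centered process with continuous paths whose
covariance is that of the stationary Ornstein–Uhlenbeck process. -/
theorem integral_sq_intervalIntegral_of_covariance {Ω : Type*} [MeasurableSpace Ω] {P : Measure Ω}
    [SFinite P] {Z : ℝ → Ω → ℝ} (hZ : Measurable (Function.uncurry Z))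
    (hL : ∀ s, MemLp (Z s) 2 P) {ε c : ℝ} (hε : 0 < ε)
    (hcov : ∀ s u, ∫ ω, Z s ω * Z u ω ∂P = c * Real.exp (-|max s 0 - max u 0| / ε))
    {a b : ℝ} (ha : 0 ≤ a) (hab : a ≤ b) :
    Integrable (fun ω => (∫ s in a..b, Z s ω) ^ 2) P ∧
      ∫ ω, (∫ s in a..b, Z s ω) ^ 2 ∂P
        = 2 * c * (ε * (b - a) + ε ^ 2 * (Real.exp (-(b - a) / ε) - 1)) := by
  have hv : ∀ s, ∫ ω, Z s ω ^ 2 ∂P ≤ c := fun s => by simp [sq, hcov]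
  simp only [intervalIntegral.integral_of_le hab]
  refine ⟨integrable_sq_integral hZ hL hv, ?_⟩
  rw [integral_sq_integral hZ hL hv]
  simp only [hcov, ← intervalIntegral.integral_of_le hab]
  have hpos : ∀ s ∈ Set.uIcc a b, max s 0 = s := fun s hs => by
    rw [Set.uIcc_of_le hab] at hs
    exact max_eq_left (ha.trans hs.1)
  rw [intervalIntegral.integral_congr
      (g := fun s => c * ∫ u in a..b, Real.exp (-|s - u| / ε)),
    intervalIntegral.integral_const_mul, integral_integral_exp_neg_abs_sub_div hε hab]
  · ring
  · intro s hs
    simp only [← intervalIntegral.integral_const_mul]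
    refine intervalIntegral.integral_congr fun u hu => ?_
    simp only [hpos s hs, hpos u hu]

section Gaussian

variable {Ω : Type*} [MeasurableSpace Ω] {P : Measure Ω}

theorem memLp_and_covariance_of_gaussian {Y : ℝ → Ω → ℝ} (hY : ∀ t, Measurable (Y t)) {ε σ : ℝ}
    (hgauss : ∀ (n : ℕ) (t : Fin n → ℝ), (∀ i, 0 ≤ t i) → ∀ a : Fin n → ℝ,
      P.map (fun ω => ∑ i, a i * Y (t i) ω) = gaussianReal 0
        (∑ i, ∑ j, a i * a j * (σ ^ 2 / 2 * Real.exp (-|t i - t j| / ε))).toNNReal) :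
    (∀ s, 0 ≤ s → MemLp (Y s) 2 P) ∧ ∀ s, 0 ≤ s → ∀ u, 0 ≤ u →
      ∫ ω, Y s ω * Y u ω ∂P = σ ^ 2 / 2 * Real.exp (-|s - u| / ε) := by
  have h1 : ∀ s, 0 ≤ s → P.map (Y s) = gaussianReal 0 (σ ^ 2 / 2).toNNReal := fun s hs => by
    simpa using hgauss 1 (fun _ => s) (fun _ => hs) (fun _ => 1)
  have hL : ∀ s, 0 ≤ s → MemLp (Y s) 2 P := fun s hs =>
    memLp_two_of_map_eq_gaussianReal (hY s) (h1 s hs)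
  have hsq : ∀ s, 0 ≤ s → ∫ ω, Y s ω ^ 2 ∂P = σ ^ 2 / 2 := fun s hs => by
    rw [integral_sq_of_map_eq_gaussianReal (hY s) (h1 s hs), Real.coe_toNNReal _ (by positivity)]
  refine ⟨hL, fun s hs u hu => ?_⟩
  have h2 : P.map (fun ω => Y s ω + Y u ω)
      = gaussianReal 0 (σ ^ 2 + σ ^ 2 * Real.exp (-|s - u| / ε)).toNNReal := by
    have h := hgauss 2 ![s, u] (by simp [Fin.forall_fin_two, hs, hu]) (fun _ => 1)
    simp only [Fin.sum_univ_two, Matrix.cons_val_zero, Matrix.cons_val_one, one_mul, sub_self,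
      abs_zero, neg_zero, zero_div, Real.exp_zero, mul_one, abs_sub_comm u s] at h
    rw [h]
    congr 2
    ring
  have h3 := integral_sq_of_map_eq_gaussianReal ((hY s).add (hY u)) h2
  rw [Real.coe_toNNReal _ (by positivity)] at h3
  have hi : Integrable (fun ω => 2 * (Y s ω * Y u ω)) P :=
    ((hL s hs).integrable_mul (hL u hu)).const_mul 2
  have ha : Integrable (fun ω => Y s ω ^ 2 + Y u ω ^ 2) P :=
    (hL s hs).integrable_sq.add (hL u hu).integrable_sq
  have h4 : ∫ ω, (Y s ω + Y u ω) ^ 2 ∂P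
      = ∫ ω, Y s ω ^ 2 ∂P + ∫ ω, Y u ω ^ 2 ∂P + 2 * ∫ ω, Y s ω * Y u ω ∂P := by
    rw [← integral_const_mul, ← integral_add (hL s hs).integrable_sq (hL u hu).integrable_sq,
      ← integral_add ha hi]
    exact integral_congr_ae (.of_forall fun ω => by simp only; ring)
  rw [hsq s hs, hsq u hu] at h4
  linarith [h3.symm.trans h4]

end Gaussian

theorem integral_qvEst {Ω : Type*} [MeasureSpace Ω] [IsProbabilityMeasure (ℙ : Measure Ω)]
    {σ ε δ : ℝ} {Y : ℝ → ℝ → Ω → ℝ} (hmeas : ∀ t, Measurable (Y ε t))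
    (hcont : ∀ᵐ ω : Ω, ContinuousOn (fun t => Y ε t ω) (Set.Ici 0))
    (hgauss : ∀ (n : ℕ) (t : Fin n → ℝ), (∀ i, 0 ≤ t i) → ∀ a : Fin n → ℝ,
      Measure.map (fun ω => ∑ i, a i * Y ε (t i) ω) (ℙ : Measure Ω) = gaussianReal 0
        (∑ i, ∑ j, a i * a j * (σ ^ 2 / 2 * Real.exp (-|t i - t j| / ε))).toNNReal)
    (hε : 0 < ε) (hδ : 0 < δ) {N : ℕ} (hN : 0 < N) :
    ∫ ω, qvEst Y ε δ N ω = σ ^ 2 * (1 + (ε / δ) * (Real.exp (-δ / ε) - 1)) := by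
  obtain ⟨hL, hcov⟩ := memLp_and_covariance_of_gaussian hmeas hgauss
  obtain ⟨Z, hZ, hZc, hZY⟩ := exists_continuous_modification hmeas hcont
  have hZY' : ∀ t, Z t =ᵐ[ℙ] Y ε (max t 0) := fun t => hZY.mono fun ω h => h t
  have hZL : ∀ t, MemLp (Z t) 2 ℙ := fun t =>
    (hL _ (le_max_right t 0)).ae_eq (hZY' t).symm
  have hZcov : ∀ s u, ∫ ω, Z s ω * Z u ω
      = σ ^ 2 / 2 * Real.exp (-|max s 0 - max u 0| / ε) := fun s u => by
    rw [← hcov _ (le_max_right s 0) _ (le_max_right u 0)]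
    exact integral_congr_ae ((hZY' s).mul (hZY' u))
  have hinc : ∀ i : ℕ, Integrable (fun ω => (∫ s in (i * δ)..((i + 1) * δ), Z s ω) ^ 2) ℙ ∧
      ∫ ω, (∫ s in (i * δ)..((i + 1) * δ), Z s ω) ^ 2
        = σ ^ 2 * (ε * δ + ε ^ 2 * (Real.exp (-δ / ε) - 1)) := fun i => by
    have h := integral_sq_intervalIntegral_of_covariance hZ hZL hε hZcov
      (a := i * δ) (b := (i + 1) * δ) (by positivity) (by nlinarith)
    have hd : ((i : ℝ) + 1) * δ - i * δ = δ := by ring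
    rw [hd, mul_div_cancel₀ _ (two_ne_zero' ℝ)] at h
    exact h
  have hsq : (ε ^ (-(1 / 2) : ℝ)) ^ 2 = ε⁻¹ := by
    rw [← Real.rpow_natCast, ← Real.rpow_mul hε.le, ← Real.rpow_neg_one]
    norm_num
  have hq : (fun ω => qvEst Y ε δ N ω) =ᵐ[ℙ] fun ω => (1 / (N * δ)) *
      ∑ i ∈ Finset.range N, ε⁻¹ * (∫ s in (i * δ)..((i + 1) * δ), Z s ω) ^ 2 := by
    filter_upwards [hZY] with ω hω
    have hslow : ∀ t, 0 ≤ t → slowKin Y ε t ω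
        = ε ^ (-(1 / 2) : ℝ) * ∫ s in (0 : ℝ)..t, Z s ω := fun t ht => by
      unfold slowKin
      congr 1
      refine intervalIntegral.integral_congr fun s hs => ?_
      rw [Set.uIcc_of_le ht] at hs
      simp only [hω, max_eq_left hs.1]
    unfold qvEst
    congr 1
    refine Finset.sum_congr rfl fun i _ => ?_
    rw [hslow _ (by positivity), hslow _ (by positivity), ← mul_sub,
      intervalIntegral.integral_interval_sub_left ((hZc ω).intervalIntegrable _ _)
        ((hZc ω).intervalIntegrable _ _), mul_pow, hsq]
  rw [integral_congr_ae hq, integral_const_mul,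
    integral_finsetSum _ fun i _ => (hinc i).1.const_mul _]
  simp only [integral_const_mul, (hinc _).2, Finset.sum_const, Finset.card_range, nsmul_eq_mul]
  have : (N : ℝ) ≠ 0 := by positivity
  field_simp

/-- For the physical Brownian motion model (with `Y^ε` the stationary OU process with
covariance `(σ²/2)e^{−|s−u|/ε}`), the quadratic-variation estimator satisfies
`E[σ̂²_{ε,δ}] = σ²(1 + (ε/δ)(e^{−δ/ε} − 1))`; consequently `E[σ̂²] → σ²` whenever
`ε/δ → 0`, and `E[σ̂²] → 0` whenever `ε/δ → ∞`. -/
theorem qvEst_mean_and_limits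
    {Ω : Type*} [MeasureSpace Ω] [IsProbabilityMeasure (ℙ : Measure Ω)]
    (σ : ℝ) (hσ : 0 < σ) (Y : ℝ → ℝ → Ω → ℝ)
    (hmeas : ∀ ε t, Measurable (Y ε t))
    (hcont : ∀ ε : ℝ, 0 < ε → ∀ᵐ ω : Ω, ContinuousOn (fun t => Y ε t ω) (Set.Ici 0))
    (hgauss : ∀ ε : ℝ, 0 < ε → ∀ (n : ℕ) (t : Fin n → ℝ), (∀ i, 0 ≤ t i) →
      ∀ a : Fin n → ℝ,
        Measure.map (fun ω => ∑ i, a i * Y ε (t i) ω) (ℙ : Measure Ω)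
          = gaussianReal 0
              (∑ i, ∑ j, a i * a j * (σ ^ 2 / 2 * Real.exp (-|t i - t j| / ε))).toNNReal) :
    (∀ ε : ℝ, 0 < ε → ∀ δ : ℝ, 0 < δ → ∀ N : ℕ, 0 < N →
      (∫ ω, qvEst Y ε δ N ω)
        = σ ^ 2 * (1 + (ε / δ) * (Real.exp (-δ / ε) - 1))) ∧
    (∀ (εs δs : ℕ → ℝ) (Ns : ℕ → ℕ), (∀ n, 0 < εs n) → (∀ n, 0 < δs n) →
      (∀ n, 0 < Ns n) →
      Tendsto (fun n => εs n / δs n) atTop (𝓝 0) →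
      Tendsto (fun n => ∫ ω, qvEst Y (εs n) (δs n) (Ns n) ω) atTop (𝓝 (σ ^ 2))) ∧
    (∀ (εs δs : ℕ → ℝ) (Ns : ℕ → ℕ), (∀ n, 0 < εs n) → (∀ n, 0 < δs n) →
      (∀ n, 0 < Ns n) →
      Tendsto (fun n => εs n / δs n) atTop atTop →
      Tendsto (fun n => ∫ ω, qvEst Y (εs n) (δs n) (Ns n) ω) atTop (𝓝 0)) := by
  have hmean : ∀ ε : ℝ, 0 < ε → ∀ δ : ℝ, 0 < δ → ∀ N : ℕ, 0 < N →
      (∫ ω, qvEst Y ε δ N ω) = σ ^ 2 * (1 + (ε / δ) * (Real.exp (-δ / ε) - 1)) :=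
    fun ε hε δ hδ N hN =>
      integral_qvEst (hmeas ε) (hcont ε hε) (hgauss ε hε) hε hδ hN
  have hmean' : ∀ (εs δs : ℕ → ℝ) (Ns : ℕ → ℕ), (∀ n, 0 < εs n) → (∀ n, 0 < δs n) →
      (∀ n, 0 < Ns n) → (fun n => ∫ ω, qvEst Y (εs n) (δs n) (Ns n) ω)
        = fun n => σ ^ 2 * (1 + (εs n / δs n) * (Real.exp (-(εs n / δs n)⁻¹) - 1)) :=
    fun εs δs Ns hε hδ hN => funext fun n => by
      rw [hmean _ (hε n) _ (hδ n) _ (hN n), inv_div, neg_div]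
  refine ⟨hmean, fun εs δs Ns hε hδ hN h => ?_, fun εs δs Ns hε hδ hN h => ?_⟩
  · rw [hmean' εs δs Ns hε hδ hN]
    simpa using (tendsto_one_add_mul_exp_neg_inv_sub_one_of_tendsto_zero
      (fun n => div_pos (hε n) (hδ n)) h).const_mul (σ ^ 2)
  · rw [hmean' εs δs Ns hε hδ hN]
    simpa using (tendsto_one_add_mul_exp_neg_inv_sub_one_of_tendsto_atTop
      (fun n => div_pos (hε n) (hδ n)) h).const_mul (σ ^ 2)
end
end
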